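/- arXiv:2106.16015 — 4 statements merged into one kernel-verified Lean document; each statement's English description precedes it below -/
import Mathlib

section
/- Let G be a 2-connected finite simple graph on vertex set V with |V| ≥ 3. Then G contains no cycle of even length if and only if G is a single odd cycle, i.e., every vertex of G has degree exactly 2 and |V| is odd. -/
open SimpleGraph

/-- A finite simple graph is 2-connected if it has at least 3 vertices, is connected,
and deleting any single vertex leaves a connected graph. -/
def TwoConnected {V : Type*} [Fintype V] (G : SimpleGraph V) : Prop :=
  3 ≤ Fintype.card V ∧ G.Connected ∧
    ∀ v : V, (G.induce {w : V | w ≠ v}).Connected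

lemma aux_first {V : Type*} (G : SimpleGraph V) (S : Set V) {c a : V} (q : G.Walk c a)
    (ha : a ∈ S) : ∃ w ∈ S, ∃ r : G.Walk c w, (∀ x ∈ r.support, x ∈ q.support) ∧
      ∀ x ∈ r.support, x ∈ S → x = w := by
  induction q with
  | nil => exact ⟨_, ha, Walk.nil, by simp, by simp⟩
  | @cons u v w h p ih =>
    by_cases hu : u ∈ S
    · exact ⟨u, hu, Walk.nil, by simp, by simp⟩
    · obtain ⟨z, hz, r, h1, h2⟩ := ih ha
      refine ⟨z, hz, Walk.cons h r, ?_, ?_⟩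
      · intro x hx
        simp only [Walk.support_cons, List.mem_cons] at hx ⊢
        exact hx.imp id (h1 x)
      · intro x hx hxS
        simp only [Walk.support_cons, List.mem_cons] at hx
        rcases hx with rfl | hx
        · exact absurd hxS hu
        · exact h2 x hx hxS

lemma aux_path {V : Type*} (G : SimpleGraph V) (v a b : V)
    (h : (G.induce {w : V | w ≠ v}).Connected) (ha : a ≠ v) (hb : b ≠ v) :
    ∃ p : G.Walk a b, p.IsPath ∧ v ∉ p.support := by
  classical
  obtain ⟨p⟩ := h.preconnected ⟨a, ha⟩ ⟨b, hb⟩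
  let p' : G.Walk a b := p.map (Embedding.induce {w : V | w ≠ v}).toHom
  have hv : v ∉ p'.support := by
    intro hv
    have hv' := hv
    erw [Walk.support_map, List.mem_map] at hv'
    obtain ⟨x, -, hx⟩ := hv'
    exact x.2 hx
  exact ⟨p'.bypass, p'.bypass_isPath, fun h => hv (p'.support_bypass_subset_support h)⟩

lemma aux_append {V : Type*} (G : SimpleGraph V) {x w y : V} (p : G.Walk x w) (q : G.Walk w y)
    (hp : p.IsPath) (hq : q.IsPath) (hd : ∀ z ∈ p.support, z ∈ q.support → z = w) :
    (p.append q).IsPath := by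
  induction p with
  | nil => simpa using hq
  | @cons u v w h p ih =>
    rw [Walk.cons_isPath_iff] at hp
    rw [Walk.cons_append, Walk.cons_isPath_iff]
    refine ⟨ih q hp.1 hq (fun z hz => hd z (by simp [hz])), ?_⟩
    rw [Walk.mem_support_append_iff]
    rintro (h1 | h1)
    · exact hp.2 h1
    · have := hd u (by simp) h1
      subst this
      exact hp.2 p.end_mem_support

lemma aux_cycle {V : Type*} (G : SimpleGraph V) {v x y : V} (r : G.Walk x y)
    (hr : r.IsPath) (hv : v ∉ r.support) (hx : G.Adj v x) (hy : G.Adj v y) (hxy : x ≠ y) :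
    ∃ c : G.Walk v v, c.IsCycle ∧ c.length = r.length + 2 := by
  refine ⟨Walk.cons hx (r.concat hy.symm), ?_, by simp⟩
  rw [Walk.cons_isCycle_iff]
  refine ⟨hr.concat hv hy.symm, ?_⟩
  rw [Walk.edges_concat, List.concat_eq_append, List.mem_append]
  rintro (h | h)
  · exact hv (r.fst_mem_support_of_mem_edges h)
  · simp only [List.mem_singleton, Sym2.eq_iff] at h
    rcases h with ⟨rfl, -⟩ | ⟨-, h⟩
    · exact hy.ne rfl
    · exact hxy h

lemma aux_theta {V : Type*} (G : SimpleGraph V) {v x y w : V} (p : G.Walk x w) (q : G.Walk y w)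
    (hp : p.IsPath) (hq : q.IsPath) (hd : ∀ z ∈ p.support, z ∈ q.support → z = w)
    (hvp : v ∉ p.support) (hvq : v ∉ q.support)
    (hx : G.Adj v x) (hy : G.Adj v y) (hxy : x ≠ y) :
    ∃ c : G.Walk v v, c.IsCycle ∧ c.length = p.length + q.length + 2 := by
  have := aux_cycle G (v := v) (p.append q.reverse)
    (aux_append G _ _ hp hq.reverse (by simpa using hd))
    (by simp [Walk.mem_support_append_iff, hvp, hvq]) hx hy hxy
  simpa using this

lemma aux_even {V : Type*} (G : SimpleGraph V) {v a b c : V}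
    (h : (G.induce {w : V | w ≠ v}).Connected)
    (ha : G.Adj v a) (hb : G.Adj v b) (hc : G.Adj v c) (hab : a ≠ b) (hac : a ≠ c) (hbc : b ≠ c) :
    ∃ (a : V) (c : G.Walk a a), c.IsCycle ∧ Even c.length := by
  classical
  obtain ⟨p, hp, hvp⟩ := aux_path G v a b h ha.ne' hb.ne'
  obtain ⟨q, hq, hvq⟩ := aux_path G v c a h hc.ne' ha.ne'
  obtain ⟨w, hw, r, h1, h2⟩ := aux_first G {x | x ∈ p.support} q p.start_mem_support
  have hw' : w ∈ p.support := hw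
  have hvr : v ∉ r.bypass.support := fun h => hvq (h1 _ (r.support_bypass_subset_support h))
  have hdr : ∀ z ∈ p.support, z ∈ r.bypass.support → z = w :=
    fun z hz hzr => h2 z (r.support_bypass_subset_support hzr) hz
  have hsub1 := p.support_takeUntil_subset_support hw'
  have hsub2 := p.support_dropUntil_subset_support hw'
  have e3 := aux_cycle G p hp hvp ha hb hab
  have hl : (p.takeUntil w hw').length + (p.dropUntil w hw').length = p.length := by
    rw [← Walk.length_append, Walk.take_spec]
  obtain ⟨c1, hc1, l1⟩ := aux_theta G (v := v) (p.takeUntil w hw') r.bypass (hp.takeUntil hw')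
    r.bypass_isPath (fun z hz => hdr z (hsub1 hz)) (fun h => hvp (hsub1 h)) hvr ha hc hac
  obtain ⟨c2, hc2, l2⟩ := aux_theta G (v := v) (p.dropUntil w hw').reverse r.bypass
    (hp.dropUntil hw').reverse
    r.bypass_isPath (fun z hz => hdr z (hsub2 (by simpa using hz)))
    (fun h => hvp (hsub2 (by simpa using h))) hvr hb hc hbc
  obtain ⟨c3, hc3, l3⟩ := e3
  rw [Walk.length_reverse] at l2
  by_cases e1 : Even c1.length
  · exact ⟨_, _, hc1, e1⟩
  by_cases e2 : Even c2.length
  · exact ⟨_, _, hc2, e2⟩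
  refine ⟨_, c3, hc3, ?_⟩
  rw [Nat.even_iff] at *
  omega

lemma aux_span {V : Type*} [Fintype V] (G : SimpleGraph V) [DecidableRel G.Adj]
    (hG : G.Connected) (hd : ∀ v : V, G.degree v = 2) {a : V} (c : G.Walk a a)
    (hc : c.IsCycle) : c.length = Fintype.card V := by
  classical
  have hcl : ∀ u v, u ∈ c.support → G.Adj u v → v ∈ c.support := by
    intro u v hu huv
    have h2 := hc.ncard_neighborSet_toSubgraph_eq_two hu
    have heq : c.toSubgraph.neighborSet u = G.neighborSet u := by
      apply Set.eq_of_subset_of_ncard_le (c.toSubgraph.neighborSet_subset u)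
      rw [h2, Set.ncard_eq_toFinset_card', ← hd u]
      exact le_of_eq rfl
    have : v ∈ c.toSubgraph.neighborSet u := by rw [heq]; exact huv
    rw [← Walk.mem_verts_toSubgraph]
    exact c.toSubgraph.edge_vert (c.toSubgraph.adj_symm this)
  have hall : ∀ v, v ∈ c.support := by
    intro v
    obtain ⟨p⟩ := hG.preconnected a v
    have key : ∀ {x y : V} (p : G.Walk x y), x ∈ c.support → y ∈ c.support := by
      intro x y p
      induction p with
      | nil => exact id
      | cons h p ih => exact fun hx => ih (hcl _ _ hx h)
    exact key p c.start_mem_support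
  have hall' : ∀ v, v ∈ c.support.tail := by
    intro v
    have := hall v
    rw [← Walk.cons_tail_support, List.mem_cons] at this
    rcases this with rfl | h
    · exact Walk.end_mem_tail_support hc.not_nil
    · exact h
  have : c.support.tail.toFinset = Finset.univ := by
    ext v; simp [hall' v]
  rw [← Finset.card_univ, ← this, List.toFinset_card_of_nodup hc.support_nodup]
  simp

lemma aux_nbr {V : Type*} [Nontrivial V] (G : SimpleGraph V) (hG : G.Connected) (v : V) :
    ∃ w, G.Adj v w := by
  obtain ⟨u, hu⟩ := exists_ne v
  obtain ⟨p⟩ := hG.preconnected v u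
  cases p with
  | nil => exact absurd rfl hu
  | cons h p => exact ⟨_, h⟩

lemma aux_two {V : Type*} [Fintype V] (G : SimpleGraph V)
    (hG : TwoConnected G) (v : V) : ∃ a b, G.Adj v a ∧ G.Adj v b ∧ a ≠ b := by
  classical
  obtain ⟨h3, hc, h2⟩ := hG
  have : Nontrivial V := Fintype.one_lt_card_iff_nontrivial.mp (by omega)
  obtain ⟨a, ha⟩ := aux_nbr G hc v
  have : Nontrivial {w : V | w ≠ a} := by
    obtain ⟨x, hx⟩ : ∃ x, x ∉ ({v, a} : Finset V) := by
      by_contra! hcon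
      have h1 := Finset.card_le_two (a := v) (b := a)
      rw [Finset.eq_univ_iff_forall.mpr hcon, Finset.card_univ] at h1
      omega
    simp only [Finset.mem_insert, Finset.mem_singleton, not_or] at hx
    exact ⟨⟨v, ha.ne⟩, ⟨x, hx.2⟩, fun h => hx.1 (congrArg Subtype.val h).symm⟩
  obtain ⟨b, hb⟩ := aux_nbr _ (h2 a) ⟨v, ha.ne⟩
  exact ⟨a, b, ha, hb, fun h => b.2 h.symm⟩

/-- A 2-connected graph on at least 3 vertices contains no even cycle iff it is a
single odd cycle, i.e. every vertex has degree exactly 2 and the number of vertices is odd. -/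
theorem stmt1 {V : Type*} [Fintype V] (G : SimpleGraph V) [DecidableRel G.Adj]
    (hG : TwoConnected G) :
    (¬ ∃ (a : V) (c : G.Walk a a), c.IsCycle ∧ Even c.length) ↔
      ((∀ v : V, G.degree v = 2) ∧ Odd (Fintype.card V)) := by
  classical
  constructor
  · intro hne
    have hd : ∀ v : V, G.degree v = 2 := by
      intro v
      obtain ⟨a, b, ha, hb, hab⟩ := aux_two G hG v
      have hsub : G.neighborFinset v = {a, b} := by
        ext c
        simp only [mem_neighborFinset, Finset.mem_insert, Finset.mem_singleton]
        constructor
        · intro hc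
          by_contra! hcon
          exact hne (aux_even G (hG.2.2 v) ha hb hc hab hcon.1.symm hcon.2.symm)
        · rintro (rfl | rfl) <;> assumption
      rw [← card_neighborFinset_eq_degree, hsub, Finset.card_pair hab]
    refine ⟨hd, ?_⟩
    obtain ⟨v⟩ := hG.2.1.nonempty
    obtain ⟨a, b, ha, hb, hab⟩ := aux_two G hG v
    obtain ⟨p, hp, hvp⟩ := aux_path G v a b (hG.2.2 v) ha.ne' hb.ne'
    obtain ⟨c, hc, -⟩ := aux_cycle G p hp hvp ha hb hab
    rw [← aux_span G hG.2.1 hd c hc, ← Nat.not_even_iff_odd]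
    exact fun h => hne ⟨_, c, hc, h⟩
  · rintro ⟨hd, ho⟩ ⟨a, c, hc, he⟩
    rw [aux_span G hG.2.1 hd c hc] at he
    exact Nat.not_even_iff_odd.mpr ho he
end

section
/- Let G be a 2-connected finite simple graph on vertex set V with |V| ≥ 3, and let S ⊆ V. Then G contains no even S-cycle if and only if either S = ∅, or all of the following hold: (a) every connected component of G − S is bipartite; (b) every vertex of S has degree exactly 2 in G; (c) for every connected component A of G − S, exactly two edges of G have exactly one endpoint in A; and (d) some S-cycle of G has odd length. -/
open SimpleGraph

namespace EvenSCycle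

variable {V : Type*} {G : SimpleGraph V}

/-- Weight of a walk, modulo 2. -/
def wt (σ : Sym2 V → ZMod 2) {u v : V} (p : G.Walk u v) : ZMod 2 := (p.edges.map σ).sum

lemma wt_append (σ : Sym2 V → ZMod 2) {u v w : V} (p : G.Walk u v) (q : G.Walk v w) :
    wt σ (p.append q) = wt σ p + wt σ q := by
  simp [wt]

lemma wt_cons (σ : Sym2 V → ZMod 2) {u v w : V} (h : G.Adj u v) (q : G.Walk v w) :
    wt σ (Walk.cons h q) = σ s(u, v) + wt σ q := by
  simp [wt]

lemma wt_reverse (σ : Sym2 V → ZMod 2) {u v : V} (p : G.Walk u v) :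
    wt σ p.reverse = wt σ p := by
  simp [wt, List.sum_reverse]

lemma wt_rotate [DecidableEq V] (σ : Sym2 V → ZMod 2) {u v : V} (c : G.Walk v v)
    (h : u ∈ c.support) : wt σ (c.rotate u h) = wt σ c := by
  unfold wt
  exact ((c.rotate_edges u h).perm.map σ).sum_eq

lemma wt_one {u v : V} (p : G.Walk u v) : wt (fun _ => 1) p = (p.length : ZMod 2) := by
  simp [wt]

/-- Appending two paths that meet only in the middle vertex. -/
lemma isPath_append {u v w : V} {p : G.Walk u v} {q : G.Walk v w} (hp : p.IsPath) (hq : q.IsPath)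
    (h : ∀ x ∈ p.support, x ∈ q.support → x = v) : (p.append q).IsPath := by
  rw [Walk.isPath_def, Walk.support_append, List.nodup_append']
  have hq' := hq.support_nodup
  rw [← Walk.cons_tail_support, List.nodup_cons] at hq'
  refine ⟨hp.support_nodup, hq'.2, ?_⟩
  intro x hx hx'
  have := h x hx (List.mem_of_mem_tail hx')
  subst this
  have hfalse : False := hq'.1 hx'
  exact hfalse.elim

/-- First entry of a walk in a set. -/
lemma first_hit (A : Set V) {u z : V} (p : G.Walk u z) (hu : u ∉ A) (hz : z ∈ A) :
    ∃ (y x : V) (q : G.Walk u y), G.Adj y x ∧ x ∈ A ∧ q.IsPath ∧ (∀ t ∈ q.support, t ∉ A) ∧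
      s(y, x) ∈ p.edges ∧ x ∈ p.support ∧ q.support ⊆ p.support ∧ q.edges ⊆ p.edges := by
  classical
  suffices H : ∃ (y x : V) (q : G.Walk u y), G.Adj y x ∧ x ∈ A ∧ (∀ t ∈ q.support, t ∉ A) ∧
      s(y, x) ∈ p.edges ∧ x ∈ p.support ∧ q.support ⊆ p.support ∧ q.edges ⊆ p.edges by
    obtain ⟨y, x, q, h1, h2, h3, h4, h5, h6, h7⟩ := H
    exact ⟨y, x, q.bypass, h1, h2, q.bypass_isPath,
      fun t ht => h3 t (q.support_bypass_subset_support ht), h4, h5,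
      fun t ht => h6 (q.support_bypass_subset_support ht), fun t ht => h7 (q.edges_bypass_subset_edges ht)⟩
  induction p with
  | nil => exact absurd hz hu
  | @cons u v z h p ih =>
    by_cases hv : v ∈ A
    · exact ⟨u, v, Walk.nil, h, hv, by simpa using hu, by simp, by simp, by simp, by simp⟩
    · obtain ⟨y, x, q, h1, h2, h3, h4, h5, h6, h7⟩ := ih hv hz
      refine ⟨y, x, Walk.cons h q, h1, h2, ?_, ?_, ?_, ?_, ?_⟩
      · intro t ht
        rw [Walk.support_cons, List.mem_cons] at ht
        rcases ht with rfl | ht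
        · exact hu
        · exact h3 t ht
      · simp [h4]
      · simp [h5]
      · rw [Walk.support_cons, Walk.support_cons]; exact List.cons_subset_cons _ h6
      · rw [Walk.edges_cons, Walk.edges_cons]; exact List.cons_subset_cons _ h7

/-- A walk in the induced subgraph on a set gives a walk of `G` in that set. -/
lemma walk_of_induce {A : Set V} {x y : V} (hx : x ∈ A) (hy : y ∈ A)
    (h : (G.induce A).Reachable ⟨x, hx⟩ ⟨y, hy⟩) :
    ∃ p : G.Walk x y, p.IsPath ∧ ∀ t ∈ p.support, t ∈ A := by
  classical
  obtain ⟨w⟩ := h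
  let p : G.Walk x y := w.map (Embedding.induce A).toHom
  refine ⟨p.bypass, p.bypass_isPath, fun t ht => ?_⟩
  have : t ∈ (w.map (Embedding.induce A).toHom).support := p.support_bypass_subset_support ht
  rw [Walk.support_map, List.mem_map] at this
  obtain ⟨a, _, rfl⟩ := this
  exact a.2

lemma walk_avoiding {v : V} (hc : (G.induce {w : V | w ≠ v}).Connected) {x y : V} (hx : x ≠ v)
    (hy : y ≠ v) : ∃ p : G.Walk x y, p.IsPath ∧ v ∉ p.support := by
  obtain ⟨p, hp, h⟩ := walk_of_induce (A := {w : V | w ≠ v}) hx hy (hc.preconnected _ _)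
  exact ⟨p, hp, fun hv => h v hv rfl⟩

/-- Theta lemma. -/
lemma theta (σ : Sym2 V → ZMod 2) {v w : V} (hc : (G.induce {w : V | w ≠ v}).Connected)
    (c : G.Walk v v) (hcyc : c.IsCycle) (hvw : G.Adj v w) (he : s(v, w) ∉ c.edges) :
    ∃ c1 c2 : G.Walk v v, c1.IsCycle ∧ c2.IsCycle ∧ s(v, w) ∈ c1.edges ∧ s(v, w) ∈ c2.edges ∧
      wt σ c1 + wt σ c2 = wt σ c := by
  classical
  obtain ⟨y, R, hyv, hyc, hR, hvR, hRc⟩ : ∃ (y : V) (R : G.Walk w y), y ≠ v ∧ y ∈ c.support ∧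
      R.IsPath ∧ v ∉ R.support ∧ ∀ t ∈ R.support, t ∈ c.support → t = y := by
    by_cases hw : w ∈ c.support
    · exact ⟨w, Walk.nil, hvw.ne', hw, by simp, by simpa using hvw.ne, by simp⟩
    · have hzv : c.snd ≠ v := (c.adj_snd hcyc.not_nil).ne'
      obtain ⟨p, _, hp⟩ := walk_avoiding hc hvw.ne' hzv
      obtain ⟨y, x, q, h1, h2, h3, h4, h5, h6, h7, h8⟩ :=
        first_hit {t | t ∈ c.support} p hw (c.getVert_mem_support 1)
      refine ⟨x, q.concat h1, ?_, h2, ?_, ?_, ?_⟩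
      · rintro rfl; exact hp h6
      · rw [Walk.concat_eq_append]
        refine isPath_append h3 (by simp [h1.ne]) ?_
        intro t ht ht'
        simp only [Walk.support_cons, Walk.support_nil, List.mem_cons, List.not_mem_nil,
          or_false] at ht'
        rcases ht' with rfl | rfl
        · rfl
        · exact absurd h2 (h4 _ ht)
      · rw [Walk.support_concat]
        intro hv
        simp only [List.mem_append, List.mem_singleton] at hv
        rcases hv with hv | rfl
        · exact hp (h7 hv)
        · exact hp h6
      · intro t ht htc
        rw [Walk.support_concat] at ht
        simp only [List.mem_append, List.mem_singleton] at ht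
        rcases ht with ht | rfl
        · exact absurd htc (h4 _ ht)
        · rfl
  have hp1 : (c.takeUntil y hyc).IsPath := hcyc.isPath_takeUntil hyc
  have hp2 : (c.dropUntil y hyc).IsPath := by
    have h := hcyc
    rw [← c.take_spec hyc] at h
    exact h.isPath_of_append_right (Walk.not_nil_of_ne hyv.symm)
  refine ⟨Walk.cons hvw (R.append (c.takeUntil y hyc).reverse),
    Walk.cons hvw (R.append (c.dropUntil y hyc)), ?_, ?_, by simp, by simp, ?_⟩
  · rw [Walk.cons_isCycle_iff]
    refine ⟨isPath_append hR hp1.reverse ?_, ?_⟩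
    · intro t ht ht'
      rw [Walk.support_reverse, List.mem_reverse] at ht'
      exact hRc t ht (c.support_takeUntil_subset_support hyc ht')
    · intro h
      simp only [Walk.edges_append, Walk.edges_reverse, List.mem_append, List.mem_reverse] at h
      rcases h with h | h
      · exact hvR (R.fst_mem_support_of_mem_edges h)
      · exact he (c.edges_takeUntil_subset_edges hyc h)
  · rw [Walk.cons_isCycle_iff]
    refine ⟨isPath_append hR hp2 ?_, ?_⟩
    · intro t ht ht'
      exact hRc t ht (c.support_dropUntil_subset_support hyc ht')
    · intro h
      simp only [Walk.edges_append, List.mem_append] at h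
      rcases h with h | h
      · exact hvR (R.fst_mem_support_of_mem_edges h)
      · exact he (c.edges_dropUntil_subset_edges hyc h)
  · conv_rhs => rw [← c.take_spec hyc]
    rw [wt_cons, wt_cons, wt_append, wt_append, wt_append, wt_reverse]
    have h2 : (2 : ZMod 2) = 0 := rfl
    linear_combination (σ s(v, w) + wt σ R) * h2

/-- In a 2-connected graph with an unbalanced cycle, each edge lies in an unbalanced cycle. -/
lemma edge_in_unbalanced (σ : Sym2 V → ZMod 2) (hconn : G.Connected)
    (h2 : ∀ v : V, (G.induce {w : V | w ≠ v}).Connected) {a : V} (c : G.Walk a a)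
    (hc : c.IsCycle) (hw : wt σ c = 1) {v w : V} (hvw : G.Adj v w) :
    ∃ c' : G.Walk v v, c'.IsCycle ∧ s(v, w) ∈ c'.edges ∧ wt σ c' = 1 := by
  classical
  have key : ∀ {v w : V}, G.Adj v w → (∃ c' : G.Walk v v, c'.IsCycle ∧ wt σ c' = 1) →
      ∃ c' : G.Walk v v, c'.IsCycle ∧ s(v, w) ∈ c'.edges ∧ wt σ c' = 1 := by
    rintro v w hvw ⟨c', hc', hw'⟩
    by_cases he : s(v, w) ∈ c'.edges
    · exact ⟨c', hc', he, hw'⟩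
    · obtain ⟨c1, c2, h1, h2, e1, e2, hs⟩ := theta σ (h2 v) c' hc' hvw he
      have h01 : ∀ x y : ZMod 2, x + y = 1 → x = 1 ∨ y = 1 := by decide
      rcases h01 _ _ (hs.trans hw') with h | h
      · exact ⟨c1, h1, e1, h⟩
      · exact ⟨c2, h2, e2, h⟩
  have step : ∀ {v w : V}, G.Walk v w → (∃ c' : G.Walk v v, c'.IsCycle ∧ wt σ c' = 1) →
      (∃ c' : G.Walk w w, c'.IsCycle ∧ wt σ c' = 1) := by
    intro v w p
    induction p with
    | nil => exact id
    | cons h p ih =>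
      intro hv
      obtain ⟨c', h1, h2, h3⟩ := key h hv
      have hm := c'.snd_mem_support_of_mem_edges h2
      exact ih ⟨c'.rotate _ hm, h1.rotate hm, by rw [wt_rotate, h3]⟩
  obtain ⟨p⟩ := hconn.preconnected a v
  exact key hvw (step p ⟨c, hc, hw⟩)

/-- Every edge of a 2-connected graph closes up to a cycle. -/
lemma edge_cycle (h3 : 3 ≤ Nat.card V)
    (h2 : ∀ v : V, (G.induce {w : V | w ≠ v}).Connected) {u v : V} (huv : G.Adj u v) :
    ∃ p : G.Walk v u, p.IsPath ∧ s(u, v) ∉ p.edges := by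
  classical
  obtain ⟨x, hxu, hxv⟩ : ∃ x, x ≠ u ∧ x ≠ v := by
    by_contra! h
    have hfin : Finite V := Nat.finite_of_card_ne_zero (by omega)
    have hsub : (Set.univ : Set V) ⊆ {u, v} := by
      intro x _
      by_cases hx : x = u
      · simp [hx]
      · simp [h x hx]
    have := Set.ncard_le_ncard hsub
    rw [Set.ncard_univ] at this
    have := Set.ncard_pair huv.ne
    omega
  obtain ⟨p, hp, hpu⟩ := walk_avoiding (h2 u) huv.ne' hxu
  obtain ⟨q, hq, hqv⟩ := walk_avoiding (h2 v) hxv huv.ne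
  refine ⟨(p.append q).bypass, Walk.bypass_isPath _, fun h => ?_⟩
  have h := Walk.edges_bypass_subset_edges _ h
  rw [Walk.edges_append, List.mem_append] at h
  rcases h with h | h
  · exact hpu (p.fst_mem_support_of_mem_edges h)
  · exact hqv (q.snd_mem_support_of_mem_edges h)

/-- Without odd cycles, each walk is shadowed by a path of the same parity. -/
lemma path_same_parity (hodd : ∀ (a : V) (c : G.Walk a a), c.IsCycle → Even c.length)
    {u v : V} (p : G.Walk u v) : ∃ q : G.Walk u v, q.IsPath ∧ (Even q.length ↔ Even p.length) := by
  classical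
  induction p with
  | nil => exact ⟨Walk.nil, by simp, Iff.rfl⟩
  | @cons u v w h p ih =>
    obtain ⟨q, hq, hpar⟩ := ih
    by_cases hu : u ∈ q.support
    · refine ⟨q.dropUntil u hu, hq.dropUntil hu, ?_⟩
      have hlen : (q.takeUntil u hu).length + (q.dropUntil u hu).length = q.length := by
        rw [← Walk.length_append, q.take_spec hu]
      have hev : Even ((q.takeUntil u hu).length + 1) := by
        by_cases h1 : (q.takeUntil u hu).length = 1
        · rw [h1]; exact ⟨1, rfl⟩
        · have h0 : (q.takeUntil u hu).length ≠ 0 := fun h0 =>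
            h.ne' (Walk.eq_of_length_eq_zero h0)
          have := hodd u (Walk.cons h (q.takeUntil u hu)) (by
            rw [Walk.isCycle_iff_isPath_tail_and_le_length]
            refine ⟨by simpa using hq.takeUntil hu, ?_⟩
            rw [Walk.length_cons]
            omega)
          simpa using this
      rw [Walk.length_cons]
      grind
    · exact ⟨Walk.cons h q, hq.cons hu, by simp [Nat.even_add_one, hpar]⟩

lemma colorable_of_no_odd_cycle
    (hodd : ∀ (a : V) (c : G.Walk a a), c.IsCycle → Even c.length) : G.Colorable 2 := by
  rw [two_colorable_iff_forall_loop_even]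
  intro u w
  obtain ⟨q, hq, h⟩ := path_same_parity hodd w
  rw [← h]
  rw [Walk.isPath_iff_nil] at hq
  simp [Walk.length_eq_zero_iff.mpr hq]

/-- A closed walk crosses a cut an even number of times. -/
lemma cut_parity (f : V → ZMod 2) (σ : Sym2 V → ZMod 2)
    (hσ : ∀ x y, G.Adj x y → σ s(x, y) = f x + f y) {u v : V} (p : G.Walk u v) :
    wt σ p = f u + f v := by
  have h2 : (2 : ZMod 2) = 0 := rfl
  induction p with
  | nil => simp only [wt, Walk.edges_nil, List.map_nil, List.sum_nil]; linear_combination (-f _) * h2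
  | @cons u v w h p ih =>
    rw [wt_cons, ih, hσ _ _ h]
    linear_combination (f v) * h2

/-- On a cycle, a vertex of degree two has both of its edges on the cycle. -/
lemma edge_mem_of_degree_two [Fintype V] [DecidableRel G.Adj] {a v w : V} (c : G.Walk a a)
    (hc : c.IsCycle) (hv : v ∈ c.support) (hd : G.degree v = 2) (hvw : G.Adj v w) :
    s(v, w) ∈ c.edges := by
  have h1 := hc.ncard_neighborSet_toSubgraph_eq_two hv
  have h2 : (G.neighborSet v).ncard = 2 := by
    rw [← hd, ← G.card_neighborSet_eq_degree, ← Nat.card_eq_fintype_card, Nat.card_coe_set_eq]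
  have h3 : c.toSubgraph.neighborSet v = G.neighborSet v :=
    Set.eq_of_subset_of_ncard_le (c.toSubgraph.neighborSet_subset v) (by omega)
  have h4 : w ∈ c.toSubgraph.neighborSet v := by rw [h3]; exact hvw
  rw [← Walk.mem_edges_toSubgraph]
  exact h4

lemma exists_edge_notMem [Fintype V] [DecidableRel G.Adj] {a v : V} (c : G.Walk a a)
    (hc : c.IsCycle) (hv : v ∈ c.support) (hd : G.degree v ≠ 2) :
    ∃ w, G.Adj v w ∧ s(v, w) ∉ c.edges := by
  by_contra! h
  have h1 := hc.ncard_neighborSet_toSubgraph_eq_two hv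
  have h3 : c.toSubgraph.neighborSet v = G.neighborSet v := by
    refine Set.Subset.antisymm (c.toSubgraph.neighborSet_subset v) fun w hw => ?_
    have := h w hw
    rw [← Walk.mem_edges_toSubgraph] at this
    exact this
  rw [h3, ← Nat.card_coe_set_eq, Nat.card_eq_fintype_card, G.card_neighborSet_eq_degree] at h1
  exact hd h1

lemma wt_flip [DecidableEq V] (e : Sym2 V) {u v : V} (p : G.Walk u v) :
    wt (fun e' => 1 + if e' = e then 1 else 0) p = (p.length : ZMod 2) + (p.edges.count e : ℕ) := by
  induction p with
  | nil => simp [wt]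
  | @cons u v w h p ih =>
    rw [wt_cons, ih, Walk.edges_cons, Walk.length_cons, List.count_cons]
    by_cases hh : s(u, v) = e
    · simp [hh]; ring
    · simp [hh]; ring

/-- An odd cycle missing an endpoint `t` of an edge yields an even cycle through `t`. -/
lemma even_cycle_of_odd_missing (hconn : G.Connected)
    (h2 : ∀ v : V, (G.induce {w : V | w ≠ v}).Connected) {a : V} (c : G.Walk a a)
    (hc : c.IsCycle) (hodd : Odd c.length) {t : V} (ht : t ∉ c.support) :
    ∃ c' : G.Walk t t, c'.IsCycle ∧ Even c'.length := by
  classical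
  have hat : t ≠ a := by rintro rfl; exact ht c.start_mem_support
  obtain ⟨p⟩ := hconn.preconnected t a
  have htw := p.adj_snd (Walk.not_nil_of_ne hat)
  set w := p.snd
  have hnot : s(t, w) ∉ c.edges := fun h => ht (c.fst_mem_support_of_mem_edges h)
  obtain ⟨c', h1, h3, h4⟩ := edge_in_unbalanced (fun e' => 1 + if e' = s(t, w) then 1 else 0)
    hconn h2 c hc (by
      rw [wt_flip, List.count_eq_zero_of_not_mem hnot]
      simpa using (ZMod.natCast_eq_one_iff_odd).mpr hodd) htw
  refine ⟨c', h1, ?_⟩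
  rw [wt_flip, List.count_eq_one_of_mem h1.isTrail.edges_nodup h3] at h4
  have : (c'.length : ZMod 2) = 0 := by simpa using h4
  exact (ZMod.natCast_eq_zero_iff_even).mp this

section Components

variable {S : Set V}

lemma comp_notMem (C : (G.induce Sᶜ).ConnectedComponent) {x : V}
    (hx : x ∈ Subtype.val '' C.supp) : x ∉ S := by
  obtain ⟨a, _, rfl⟩ := hx
  exact a.2

lemma comp_adj (C : (G.induce Sᶜ).ConnectedComponent) {x y : V}
    (hx : x ∈ Subtype.val '' C.supp) (hxy : G.Adj x y) (hy : y ∉ S) :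
    y ∈ Subtype.val '' C.supp := by
  obtain ⟨a, ha, rfl⟩ := hx
  refine ⟨⟨y, hy⟩, ?_, rfl⟩
  have : (G.induce Sᶜ).Adj a ⟨y, hy⟩ := hxy
  exact (C.mem_supp_congr_adj this).mp ha

lemma comp_path (C : (G.induce Sᶜ).ConnectedComponent) {x y : V}
    (hx : x ∈ Subtype.val '' C.supp) (hy : y ∈ Subtype.val '' C.supp) :
    ∃ p : G.Walk x y, p.IsPath ∧ ∀ t ∈ p.support, t ∈ Subtype.val '' C.supp := by
  classical
  obtain ⟨a, ha, rfl⟩ := hx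
  obtain ⟨b, hb, rfl⟩ := hy
  obtain ⟨w⟩ := C.reachable_of_mem_supp ha hb
  let p : G.Walk a.1 b.1 := w.map (Embedding.induce Sᶜ).toHom
  refine ⟨p.bypass, p.bypass_isPath, fun t ht => ?_⟩
  have : t ∈ (w.map (Embedding.induce Sᶜ).toHom).support := p.support_bypass_subset_support ht
  rw [Walk.support_map, List.mem_map] at this
  obtain ⟨d, hd, rfl⟩ := this
  refine ⟨d, ?_, rfl⟩
  have hr : (G.induce Sᶜ).Reachable a d := ⟨w.takeUntil d hd⟩
  rw [ConnectedComponent.mem_supp_iff] at ha ⊢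
  rw [← ha]
  exact (ConnectedComponent.sound hr).symm

end Components

/-- The boundary has exactly two edges if all cycles meeting `S` contain all edges at `S`. -/
lemma boundary_two (h3 : 3 ≤ Nat.card V) (hconn : G.Connected)
    (h2 : ∀ v : V, (G.induce {w : V | w ≠ v}).Connected) {S : Set V} (hS : S.Nonempty)
    (hall : ∀ (a : V) (c : G.Walk a a), c.IsCycle → (∃ w ∈ S, w ∈ c.support) →
      ∀ x y, G.Adj x y → x ∈ S → s(x, y) ∈ c.edges)
    (C : (G.induce Sᶜ).ConnectedComponent) :
    {e ∈ G.edgeSet | ∃ x y : V, e = s(x, y) ∧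
              x ∈ Subtype.val '' C.supp ∧ y ∉ Subtype.val '' C.supp}.ncard = 2 := by
  obtain ⟨s, hs⟩ := hS
  obtain ⟨a', ha'⟩ := C.nonempty_supp
  have hA' : (a' : V) ∈ Subtype.val '' C.supp := ⟨a', ha', rfl⟩
  set A : Set V := Subtype.val '' C.supp with hA
  have hAS : ∀ x ∈ A, x ∉ S := fun x hx => comp_notMem C hx
  have hAadj : ∀ x y, x ∈ A → G.Adj x y → y ∉ A → y ∈ S := by
    intro x y hx hxy hy
    by_contra hyS
    exact hy (comp_adj C hx hxy hyS)
  obtain ⟨p0⟩ := hconn.preconnected s a'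
  obtain ⟨s1, a1, q0, hadj0, ha1, -, hq0, -⟩ := first_hit A p0 (fun h => hAS _ h hs) hA'
  have hs1A : s1 ∉ A := hq0 s1 q0.end_mem_support
  have hs1S : s1 ∈ S := hAadj a1 s1 ha1 hadj0.symm hs1A
  obtain ⟨p, hp, hpe⟩ := edge_cycle h3 h2 hadj0.symm
  obtain ⟨y, x, q, hyx, hxA, hq, hqA, hyxp, -, -, hqp⟩ := first_hit A p hs1A ha1
  obtain ⟨r, hr, hrA⟩ := comp_path C hxA ha1
  have hyA : y ∉ A := hqA y q.end_mem_support
  have hne : s(a1, s1) ≠ s(y, x) := fun h => hpe (h ▸ hyxp)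
  have hpath : (q.append (Walk.cons hyx r)).IsPath := by
    refine isPath_append hq (hr.cons fun h => hyA (hrA _ h)) ?_
    intro t ht ht'
    rw [Walk.support_cons, List.mem_cons] at ht'
    rcases ht' with h | h
    · exact h
    · exact absurd (hrA _ h) (hqA _ ht)
  have hcyc : (Walk.cons hadj0.symm (q.append (Walk.cons hyx r))).IsCycle := by
    rw [Walk.cons_isCycle_iff]
    refine ⟨hpath, fun h => ?_⟩
    rw [Walk.edges_append, Walk.edges_cons, List.mem_append, List.mem_cons] at h
    rcases h with h | h | h
    · exact hpe (hqp h)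
    · exact hne h
    · exact hs1A (hrA _ (r.snd_mem_support_of_mem_edges h))
  have hedges := hall _ _ hcyc ⟨s1, hs1S, by simp⟩
  rw [Set.ncard_eq_two]
  refine ⟨s(a1, s1), s(y, x), hne, ?_⟩
  ext e
  constructor
  · rintro ⟨he, b, z, rfl, hb, hz⟩
    have hbz : G.Adj b z := he
    have hm := hedges z b hbz.symm (hAadj b z hb hbz hz)
    rw [Sym2.eq_swap] at hm
    rw [Walk.edges_cons, Walk.edges_append, Walk.edges_cons, List.mem_cons, List.mem_append,
      List.mem_cons] at hm
    rcases hm with h | h | h | h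
    · exact Or.inl h
    · exact absurd hb (hqA _ (q.fst_mem_support_of_mem_edges h))
    · exact Or.inr h
    · exact absurd (hrA _ (r.snd_mem_support_of_mem_edges h)) hz
  · rintro (rfl | rfl)
    · exact ⟨hadj0.symm, a1, s1, rfl, ha1, hs1A⟩
    · exact ⟨hyx, x, y, Sym2.eq_swap, hxA, hyA⟩

lemma forward [Fintype V] [DecidableRel G.Adj] (hG : TwoConnected G) {S : Set V} (hS : S.Nonempty)
    (hno : ∀ (a : V) (c : G.Walk a a), c.IsCycle → (∃ w ∈ S, w ∈ c.support) → Odd c.length) :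
    ((∀ C : (G.induce Sᶜ).ConnectedComponent,
            ((G.induce Sᶜ).induce C.supp).Colorable 2) ∧
         (∀ w ∈ S, G.degree w = 2) ∧
         (∀ C : (G.induce Sᶜ).ConnectedComponent,
            {e ∈ G.edgeSet | ∃ x y : V, e = s(x, y) ∧
              x ∈ Subtype.val '' C.supp ∧ y ∉ Subtype.val '' C.supp}.ncard = 2) ∧
         (∃ (a : V) (c : G.Walk a a), c.IsCycle ∧ Odd c.length ∧ ∃ w ∈ S, w ∈ c.support)) := by
  classical
  obtain ⟨h3, hconn, h2⟩ := hG
  rw [← Nat.card_eq_fintype_card] at h3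
  have hcov : ∀ (a : V) (c : G.Walk a a), c.IsCycle → Odd c.length → ∀ t ∈ S, t ∈ c.support := by
    intro a c hc ho t ht
    by_contra htc
    obtain ⟨c', h1, h4⟩ := even_cycle_of_odd_missing hconn h2 c hc ho htc
    exact (Nat.not_even_iff_odd.mpr (hno t c' h1 ⟨t, ht, c'.start_mem_support⟩)) h4
  have hex : ∀ s ∈ S, ∃ c : G.Walk s s, c.IsCycle := by
    intro s _
    obtain ⟨b, hb⟩ : ∃ b, b ≠ s := by
      have : Nontrivial V := Finite.one_lt_card_iff_nontrivial.mp (by omega)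
      exact exists_ne s
    obtain ⟨p⟩ := hconn.preconnected s b
    have hadj := p.adj_snd (Walk.not_nil_of_ne hb.symm)
    obtain ⟨q, hq, hqe⟩ := edge_cycle h3 h2 hadj
    exact ⟨Walk.cons hadj q, (Walk.cons_isCycle_iff _ _).mpr ⟨hq, hqe⟩⟩
  have hdeg : ∀ w ∈ S, G.degree w = 2 := by
    intro s hs
    by_contra hd
    obtain ⟨c, hc⟩ := hex s hs
    obtain ⟨w, hw, he⟩ := exists_edge_notMem c hc c.start_mem_support hd
    obtain ⟨c1, c2, hc1, hc2, -, -, hsum⟩ := theta (fun _ => 1) (h2 s) c hc hw he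
    have o := hno s c hc ⟨s, hs, c.start_mem_support⟩
    have o1 := hno s c1 hc1 ⟨s, hs, c1.start_mem_support⟩
    have o2 := hno s c2 hc2 ⟨s, hs, c2.start_mem_support⟩
    rw [wt_one, wt_one, wt_one, (ZMod.natCast_eq_one_iff_odd).mpr o,
      (ZMod.natCast_eq_one_iff_odd).mpr o1, (ZMod.natCast_eq_one_iff_odd).mpr o2] at hsum
    exact absurd hsum (by decide)
  refine ⟨?_, hdeg, ?_, ?_⟩
  · have hcol : (G.induce Sᶜ).Colorable 2 := by
      apply colorable_of_no_odd_cycle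
      intro a c hc
      by_contra ho
      rw [Nat.not_even_iff_odd] at ho
      obtain ⟨s, hs⟩ := hS
      have hinj : Function.Injective (Embedding.induce (G := G) Sᶜ).toHom :=
        (Embedding.induce (G := G) Sᶜ).injective
      have := hcov _ (c.map (Embedding.induce (G := G) Sᶜ).toHom) (hc.map hinj)
        (by rw [Walk.length_map]; exact ho) s hs
      rw [Walk.support_map, List.mem_map] at this
      obtain ⟨d, _, hd⟩ := this
      have hd' : (d : V) = s := hd
      exact d.2 (by rw [hd']; exact hs)
    exact fun C => colorable_iff_forall_connectedComponent.mp hcol C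
  · refine boundary_two h3 hconn h2 hS ?_
    intro a c hc hw x y hxy hx
    exact edge_mem_of_degree_two c hc (hcov a c hc (hno a c hc hw) x hx) (hdeg x hx) hxy
  · obtain ⟨s, hs⟩ := hS
    obtain ⟨c, hc⟩ := hex s hs
    have h := (⟨s, hs, c.start_mem_support⟩ : ∃ w ∈ S, w ∈ c.support)
    exact ⟨s, c, hc, hno s c hc h, h⟩

/-- If a cycle uses a boundary edge of `A`, and there are only two, it uses all of them. -/
lemma boundary_all {A : Set V} (hcard : {e ∈ G.edgeSet | ∃ x y : V, e = s(x, y) ∧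
      x ∈ A ∧ y ∉ A}.ncard = 2) {a : V} (c : G.Walk a a) (hc : c.IsCycle) {x y : V}
    (hx : x ∈ A) (hy : y ∉ A) (hm : s(x, y) ∈ c.edges) {x' y' : V} (hxy' : G.Adj x' y')
    (hx' : x' ∈ A) (hy' : y' ∉ A) : s(x', y') ∈ c.edges := by
  classical
  by_contra hm'
  set B := {e ∈ G.edgeSet | ∃ x y : V, e = s(x, y) ∧ x ∈ A ∧ y ∉ A} with hB
  have hxB : s(x, y) ∈ B := ⟨c.edges_subset_edgeSet hm, x, y, rfl, hx, hy⟩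
  have hxB' : s(x', y') ∈ B := ⟨hxy', x', y', rfl, hx', hy'⟩
  have hne : s(x, y) ≠ s(x', y') := fun h => hm' (h ▸ hm)
  have hBe : B = {s(x, y), s(x', y')} := by
    symm
    apply Set.eq_of_subset_of_ncard_le
    · rintro e (rfl | rfl)
      exacts [hxB, hxB']
    · rw [hcard, Set.ncard_pair hne]
    · exact Set.finite_of_ncard_ne_zero (by omega)
  let f : V → ZMod 2 := fun v => if v ∈ A then 1 else 0
  let σ : Sym2 V → ZMod 2 := fun e => if e ∈ B then 1 else 0
  have hpar := cut_parity (G := G) f σ (by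
    intro u v huv
    have hiff : s(u, v) ∈ B ↔ (u ∈ A ∧ v ∉ A) ∨ (v ∈ A ∧ u ∉ A) := by
      constructor
      · rintro ⟨_, b, z, h, hb, hz⟩
        rw [Sym2.eq_iff] at h
        rcases h with ⟨rfl, rfl⟩ | ⟨rfl, rfl⟩
        · exact Or.inl ⟨hb, hz⟩
        · exact Or.inr ⟨hb, hz⟩
      · rintro (⟨h1, h2⟩ | ⟨h1, h2⟩)
        · exact ⟨huv, u, v, rfl, h1, h2⟩
        · exact ⟨huv, v, u, Sym2.eq_swap, h1, h2⟩
    simp only [σ, f, hiff]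
    by_cases h1 : u ∈ A <;> by_cases h2 : v ∈ A <;> simp [h1, h2] <;> rfl) c
  have h2 : f a + f a = 0 := by
    have h2 : (2 : ZMod 2) = 0 := rfl
    linear_combination (f a) * h2
  rw [h2] at hpar
  have hcount : wt σ c = (c.edges.count s(x, y) : ℕ) := by
    rw [wt, List.count_eq_countP]
    have : ∀ l : List (Sym2 V), s(x', y') ∉ l →
        (l.map σ).sum = (l.countP (fun e => e == s(x, y)) : ℕ) := by
      intro l
      induction l with
      | nil => simp
      | cons e l ih =>
        intro hl
        rw [List.mem_cons, not_or] at hl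
        rw [List.map_cons, List.sum_cons, ih hl.2, List.countP_cons]
        by_cases he : e = s(x, y)
        · have : σ e = 1 := if_pos (by rw [he]; exact hxB)
          rw [this]; simp [he]; ring
        · have : σ e = 0 := if_neg (by
            rw [hBe]; rintro (h | h)
            · exact he h
            · exact hl.1 h.symm)
          rw [this]; simp [he]
    exact this _ hm'
  rw [hcount, List.count_eq_one_of_mem hc.isTrail.edges_nodup hm] at hpar
  exact absurd hpar (by decide)

/-- Under (b) and (c) an `S`-cycle contains every edge at `S`. -/
lemma all_edges [Fintype V] [DecidableRel G.Adj] (hconn : G.Connected) {S : Set V}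
    (hdeg : ∀ w ∈ S, G.degree w = 2)
    (hbd : ∀ C : (G.induce Sᶜ).ConnectedComponent,
            {e ∈ G.edgeSet | ∃ x y : V, e = s(x, y) ∧
              x ∈ Subtype.val '' C.supp ∧ y ∉ Subtype.val '' C.supp}.ncard = 2)
    {a : V} (c : G.Walk a a) (hc : c.IsCycle) (hw : ∃ w ∈ S, w ∈ c.support) {x y : V}
    (hx : x ∈ S) (hxy : G.Adj x y) : s(x, y) ∈ c.edges := by
  let P : V → Prop := fun v => (v ∈ S → v ∈ c.support) ∧
    ∀ C : (G.induce Sᶜ).ConnectedComponent, v ∈ Subtype.val '' C.supp →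
      ∀ b z, G.Adj b z → b ∈ Subtype.val '' C.supp → z ∉ Subtype.val '' C.supp →
        s(b, z) ∈ c.edges
  have step : ∀ u v, G.Adj u v → P u → P v := by
    intro u v huv ⟨h1, h2⟩
    by_cases hu : u ∈ S
    · have hm : s(u, v) ∈ c.edges := edge_mem_of_degree_two c hc (h1 hu) (hdeg u hu) huv
      refine ⟨fun _ => c.snd_mem_support_of_mem_edges hm, fun C hv b z hbz hb hz => ?_⟩
      exact boundary_all (hbd C) c hc hv (fun h => comp_notMem C h hu)
        (by rwa [Sym2.eq_swap]) hbz hb hz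
    · have hu' : u ∈ Subtype.val '' ((G.induce Sᶜ).connectedComponentMk ⟨u, hu⟩).supp :=
        ⟨⟨u, hu⟩, rfl, rfl⟩
      refine ⟨fun hv => ?_, fun C hv => ?_⟩
      · have := h2 _ hu' u v huv hu' (fun h => comp_notMem _ h hv)
        exact c.snd_mem_support_of_mem_edges this
      · exact h2 C (comp_adj C hv huv.symm hu)
  have hwalk : ∀ u v, G.Walk u v → P u → P v := by
    intro u v p
    induction p with
    | nil => exact id
    | cons h p ih => exact fun hu => ih (step _ _ h hu)
  obtain ⟨w, hwS, hwc⟩ := hw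
  have hPw : P w := ⟨fun _ => hwc, fun C h => absurd hwS (comp_notMem C h)⟩
  obtain ⟨p⟩ := hconn.preconnected w x
  exact edge_mem_of_degree_two c hc ((hwalk _ _ p hPw).1 hx) (hdeg x hx) hxy

lemma backward [Fintype V] [DecidableRel G.Adj] (hconn : G.Connected) {S : Set V}
    (hcol : ∀ C : (G.induce Sᶜ).ConnectedComponent,
            ((G.induce Sᶜ).induce C.supp).Colorable 2)
    (hdeg : ∀ w ∈ S, G.degree w = 2)
    (hbd : ∀ C : (G.induce Sᶜ).ConnectedComponent,
            {e ∈ G.edgeSet | ∃ x y : V, e = s(x, y) ∧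
              x ∈ Subtype.val '' C.supp ∧ y ∉ Subtype.val '' C.supp}.ncard = 2)
    {a b : V} (c : G.Walk a a) (hc : c.IsCycle) (hw : ∃ w ∈ S, w ∈ c.support)
    (d : G.Walk b b) (hd : d.IsCycle) (hw' : ∃ w ∈ S, w ∈ d.support) :
    (c.length : ZMod 2) = d.length := by
  classical
  obtain ⟨κ⟩ := colorable_iff_forall_connectedComponent.mpr hcol
  -- 2-colouring of `G - S`, extended by zero
  let f : V → ZMod 2 := fun v => if h : v ∈ S then 0 else (κ ⟨v, h⟩ : ZMod 2)
  have hf : ∀ u v, G.Adj u v → u ∉ S → v ∉ S → f u + f v = 1 := by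
    intro u v huv hu hv
    have hval : κ ⟨u, hu⟩ ≠ κ ⟨v, hv⟩ := κ.valid huv
    have hfu : f u = κ ⟨u, hu⟩ := dif_neg hu
    have hfv : f v = κ ⟨v, hv⟩ := dif_neg hv
    rw [hfu, hfv]
    have : ∀ i j : ZMod 2, i ≠ j → i + j = 1 := by decide
    exact this _ _ hval
  let σ : Sym2 V → ZMod 2 := Sym2.lift ⟨fun u v => f u + f v, fun u v => add_comm _ _⟩
  have hpar : ∀ {a : V} (c : G.Walk a a), wt σ c = 0 := by
    intro a c
    rw [cut_parity f σ (fun _ _ _ => rfl) c]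
    have h2 : (2 : ZMod 2) = 0 := rfl
    linear_combination (f a) * h2
  -- weight of the cycle equals a sum over edges at `S`
  let τ : Sym2 V → ZMod 2 := fun e => 1 + σ e
  have hτ : ∀ {a : V} (c : G.Walk a a), wt τ c = c.length := by
    intro a c
    have : wt τ c = wt (fun _ => 1) c + wt σ c := by
      simp only [wt, τ, List.sum_map_add]
    rw [this, hpar, wt_one, add_zero]
  have hsum : ∀ {a : V} (c : G.Walk a a), c.IsCycle → (∃ w ∈ S, w ∈ c.support) →
      wt τ c = ∑ e ∈ Finset.univ.filter (fun e => e ∈ G.edgeSet ∧ ∃ x ∈ S, x ∈ e), τ e := by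
    intro a c hc hw
    rw [wt, ← List.sum_toFinset _ hc.isTrail.edges_nodup]
    symm
    apply Finset.sum_subset
    · intro e he
      simp only [Finset.mem_filter, Finset.mem_univ, true_and] at he
      obtain ⟨he, x, hx, hxe⟩ := he
      obtain ⟨y, rfl⟩ := Sym2.mem_iff_exists.mp hxe
      rw [List.mem_toFinset]
      exact all_edges hconn hdeg hbd c hc hw hx he
    · intro e he hne
      rw [List.mem_toFinset] at he
      have heG := c.edges_subset_edgeSet he
      induction e with
      | _ u v =>
        simp only [Finset.mem_filter, Finset.mem_univ, true_and, not_and, not_exists] at hne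
        have hne := hne heG
        have h1 := hf u v heG (fun h => hne u h (by simp)) (fun h => hne v h (by simp))
        change 1 + (f u + f v) = 0
        rw [h1]; rfl
  rw [← hτ c, ← hτ d, hsum c hc hw, hsum d hd hw']

end EvenSCycle

theorem stmt3 {V : Type*} [Fintype V] (G : SimpleGraph V) [DecidableRel G.Adj]
    (hG : TwoConnected G) (S : Set V) :
    (¬ ∃ (a : V) (c : G.Walk a a), c.IsCycle ∧ Even c.length ∧ ∃ w ∈ S, w ∈ c.support) ↔
      (S = ∅ ∨
        ((∀ C : (G.induce Sᶜ).ConnectedComponent,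
            ((G.induce Sᶜ).induce C.supp).Colorable 2) ∧
         (∀ w ∈ S, G.degree w = 2) ∧
         (∀ C : (G.induce Sᶜ).ConnectedComponent,
            {e ∈ G.edgeSet | ∃ x y : V, e = s(x, y) ∧
              x ∈ Subtype.val '' C.supp ∧ y ∉ Subtype.val '' C.supp}.ncard = 2) ∧
         (∃ (a : V) (c : G.Walk a a), c.IsCycle ∧ Odd c.length ∧ ∃ w ∈ S, w ∈ c.support))) := by
  constructor
  · intro hno
    rcases S.eq_empty_or_nonempty with hS | hS
    · exact Or.inl hS
    · refine Or.inr (EvenSCycle.forward hG hS ?_)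
      intro a c hc hw
      rw [← Nat.not_even_iff_odd]
      exact fun he => hno ⟨a, c, hc, he, hw⟩
  · rintro (rfl | ⟨hcol, hdeg, hbd, b, d, hd, hodd, hw'⟩)
    · rintro ⟨a, c, _, _, w, hw, _⟩
      exact hw
    · rintro ⟨a, c, hc, heven, hw⟩
      have h := EvenSCycle.backward hG.2.1 hcol hdeg hbd c hc hw d hd hw'
      rw [(ZMod.natCast_eq_zero_iff_even).mpr heven, (ZMod.natCast_eq_one_iff_odd).mpr hodd] at h
      exact absurd h (by decide)
end

section
/- Let G be a 2-connected finite simple graph on vertex set V with |V| ≥ 3, and let S ⊆ V be nonempty. If G contains no even S-cycle, then every connected component of G − S is bipartite. -/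
open SimpleGraph

namespace Fan14

variable {V : Type*} {G : SimpleGraph V}

lemma append_path {u v w : V} {p : G.Walk u v} {q : G.Walk v w} (hp : p.IsPath) (hq : q.IsPath)
    (h : ∀ x ∈ p.support, x ∈ q.support → x = v) : (p.append q).IsPath := by
  rw [Walk.isPath_def, Walk.support_append, List.nodup_append']
  refine ⟨hp.support_nodup, hq.support_nodup.tail, ?_⟩
  intro x hx hx'
  have := h x hx (List.mem_of_mem_tail hx')
  subst this
  have h2 := hq.support_nodup
  rw [← Walk.cons_tail_support] at h2
  exact (List.nodup_cons.1 h2).1 hx'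

lemma path_split {u v w : V} {p : G.Walk u v} (hp : p.IsPath) (hw : w ∈ p.support) :
    ∃ (q : G.Walk u w) (r : G.Walk w v), q.IsPath ∧ r.IsPath ∧
      (∀ x, x ∈ p.support ↔ x ∈ q.support ∨ x ∈ r.support) ∧
      ∀ x ∈ q.support, x ∈ r.support → x = w := by
  obtain ⟨q, r, hq, hr, rfl⟩ := hp.mem_support_iff_exists_append.1 hw
  refine ⟨q, r, hq, hr, fun x => Walk.mem_support_append_iff _ _, ?_⟩
  intro x h1 h2
  by_contra hne
  exact hp.ne_of_mem_support_of_append hne h1 h2 rfl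

lemma hit (D : Set V) {w t : V} (R : G.Walk w t) (ht : t ∈ D) :
    ∃ z ∈ D, ∃ R' : G.Walk w z, R'.IsPath ∧ (∀ x ∈ R'.support, x ∈ R.support) ∧
      ∀ x ∈ R'.support, x ∈ D → x = z := by
  classical
  induction R with
  | nil => exact ⟨_, ht, .nil, by simp⟩
  | @cons a b c hab p ih =>
    by_cases ha : a ∈ D
    · exact ⟨a, ha, .nil, by simp, by simp, by simp⟩
    obtain ⟨z, hz, R', h1, h2, h3⟩ := ih ht
    by_cases haR : a ∈ R'.support
    · obtain ⟨q, r, hq, hr, hs, _⟩ := path_split h1 haR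
      refine ⟨z, hz, r, hr, fun x hx => ?_, fun x hx => h3 x ((hs x).2 (.inr hx))⟩
      simp [h2 x ((hs x).2 (.inr hx))]
    · refine ⟨z, hz, .cons hab R', by simp [h1, haR], ?_, ?_⟩
      · intro x hx
        simp only [Walk.support_cons, List.mem_cons] at hx ⊢
        exact hx.imp id (h2 x)
      · intro x hx hxD
        simp only [Walk.support_cons, List.mem_cons] at hx
        rcases hx with rfl | hx
        · exact absurd hxD ha
        · exact h3 x hx hxD

lemma avoid {v : V} (hv : (G.induce {w : V | w ≠ v}).Connected) {a b : V} (ha : a ≠ v)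
    (hb : b ≠ v) : ∃ R : G.Walk a b, v ∉ R.support := by
  obtain ⟨R⟩ := hv.preconnected ⟨a, ha⟩ ⟨b, hb⟩
  refine ⟨R.map (Embedding.induce _).toHom, ?_⟩
  intro h
  have h' := (Walk.support_map (Embedding.induce _).toHom R) ▸ h
  obtain ⟨x, _, hx⟩ := List.mem_map.1 h'
  exact x.2 hx

/-- Two paths from `v` to distinct vertices of `C`, sharing only `v`, and meeting `C` only at
their ends. -/
def HasFan (G : SimpleGraph V) (C : Set V) (v : V) : Prop :=
  ∃ x ∈ C, ∃ y ∈ C, ∃ (P : G.Walk v x) (Q : G.Walk v y), P.IsPath ∧ Q.IsPath ∧ x ≠ y ∧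
    (∀ u ∈ P.support, u ∈ Q.support → u = v) ∧
    (∀ u ∈ P.support, u ∈ C → u = x) ∧ (∀ u ∈ Q.support, u ∈ C → u = y)

lemma fan_base {C : Set V} {c d w : V} (hv : (G.induce {w : V | w ≠ c}).Connected)
    (hc : c ∈ C) (hd : d ∈ C) (hcd : d ≠ c) (hw : w ∉ C) (hcw : G.Adj c w) : HasFan G C w := by
  have hwc : w ≠ c := fun h => hw (h ▸ hc)
  obtain ⟨R, hR⟩ := avoid hv hwc hcd
  obtain ⟨z, hz, R', h1, h2, h3⟩ := hit C R hd
  have hcR : c ∉ R'.support := fun h => hR (h2 _ h)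
  have hzc : c ≠ z := fun h => hcR (h ▸ R'.end_mem_support)
  refine ⟨c, hc, z, hz, .cons hcw.symm .nil, R', by simp [hwc], h1, hzc, ?_, ?_, h3⟩
  · intro u hu hu'
    simp at hu
    grind
  · intro u hu hu'
    simp at hu
    grind

lemma fan_reroute {C : Set V} {v w x y : V} (hw : w ∉ C)
    (hx : x ∈ C) (hy : y ∈ C) (P : G.Walk v x) (Q : G.Walk v y) (hP : P.IsPath) (hQ : Q.IsPath)
    (hxy : x ≠ y) (hPQ : ∀ u ∈ P.support, u ∈ Q.support → u = v)
    (hPC : ∀ u ∈ P.support, u ∈ C → u = x) (hQC : ∀ u ∈ Q.support, u ∈ C → u = y)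
    (hwv : w ≠ v) (hwP : w ∈ P.support) : HasFan G C w := by
  obtain ⟨P1, P2, h1, h2, hs, hd⟩ := path_split hP hwP
  have hvP1 : v ∈ P1.support := P1.start_mem_support
  have hxP2 : x ∈ P2.support := P2.end_mem_support
  have hwx : w ≠ x := fun h => hw (h ▸ hx)
  refine ⟨x, hx, y, hy, P2, P1.reverse.append Q, h2, append_path h1.reverse hQ ?_, hxy,
    ?_, ?_, ?_⟩
  · intro u hu hu'
    simp at hu
    exact hPQ u ((hs u).2 (.inl hu)) hu'
  · intro u hu hu'
    simp [Walk.mem_support_append_iff] at hu'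
    grind
  · grind
  · intro u hu hu'
    simp [Walk.mem_support_append_iff] at hu
    grind

lemma fan_hit {C : Set V} {v w x y z : V} (hwadj : G.Adj v w)
    (hx : x ∈ C) (hy : y ∈ C) (P : G.Walk v x) (Q : G.Walk v y) (hP : P.IsPath) (hQ : Q.IsPath)
    (hxy : x ≠ y) (hPQ : ∀ u ∈ P.support, u ∈ Q.support → u = v)
    (hPC : ∀ u ∈ P.support, u ∈ C → u = x) (hQC : ∀ u ∈ Q.support, u ∈ C → u = y)
    (hwC : w ∉ C) (hwP : w ∉ P.support) (hwQ : w ∉ Q.support)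
    (R : G.Walk w z) (hR : R.IsPath) (hvR : v ∉ R.support)
    (hRD : ∀ u ∈ R.support, (u ∈ C ∨ u ∈ P.support ∨ u ∈ Q.support) → u = z)
    (hz : z ∈ P.support) : HasFan G C w := by
  obtain ⟨P1, P2, h1, h2, hs, hd⟩ := path_split hP hz
  have hzR : z ∈ R.support := R.end_mem_support
  have hzv : z ≠ v := fun h => hvR (h ▸ hzR)
  have hvP1 : v ∈ P1.support := P1.start_mem_support
  have hxP2 : x ∈ P2.support := P2.end_mem_support
  refine ⟨x, hx, y, hy, R.append P2, .cons hwadj.symm Q, append_path hR h2 ?_,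
    by simp [hQ, hwQ], hxy, ?_, ?_, ?_⟩
  · grind
  · intro u hu hu'
    simp [Walk.mem_support_append_iff] at hu hu'
    grind
  · intro u hu hu'
    simp [Walk.mem_support_append_iff] at hu
    grind
  · intro u hu hu'
    simp at hu
    grind

lemma fan_hitC {C : Set V} {v w x z : V} (hwadj : G.Adj v w)
    (hx : x ∈ C) (P : G.Walk v x) (hP : P.IsPath)
    (hPC : ∀ u ∈ P.support, u ∈ C → u = x)
    (hwC : w ∉ C) (hwP : w ∉ P.support)
    (R : G.Walk w z) (hR : R.IsPath)
    (hRD : ∀ u ∈ R.support, (u ∈ C ∨ u ∈ P.support) → u = z)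
    (hzC : z ∈ C) (hz : z ∉ P.support) : HasFan G C w := by
  have hxP : x ∈ P.support := P.end_mem_support
  refine ⟨x, hx, z, hzC, .cons hwadj.symm P, R, by simp [hP, hwP], hR, by grind, ?_, ?_, ?_⟩
  · intro u hu hu'
    simp at hu
    grind
  · intro u hu hu'
    simp at hu
    grind
  · grind

lemma fan_step {C : Set V} {v w : V} (hv : (G.induce {w : V | w ≠ v}).Connected)
    (hvC : v ∉ C) (hwC : w ∉ C) (hadj : G.Adj v w) (hf : HasFan G C v) : HasFan G C w := by
  obtain ⟨x, hx, y, hy, P, Q, hP, hQ, hxy, hPQ, hPC, hQC⟩ := hf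
  have hQP : ∀ u ∈ Q.support, u ∈ P.support → u = v := fun u a b => hPQ u b a
  have hwv : w ≠ v := hadj.ne'
  by_cases hwP : w ∈ P.support
  · exact fan_reroute hwC hx hy P Q hP hQ hxy hPQ hPC hQC hwv hwP
  by_cases hwQ : w ∈ Q.support
  · exact fan_reroute hwC hy hx Q P hQ hP hxy.symm hQP hQC hPC hwv hwQ
  have hxv : x ≠ v := fun h => hvC (h ▸ hx)
  obtain ⟨R, hR⟩ := avoid hv hwv hxv
  obtain ⟨z, hz, R', h1, h2, h3⟩ := hit {u | u ∈ C ∨ u ∈ P.support ∨ u ∈ Q.support} R (.inl hx)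
  have hvR : v ∉ R'.support := fun h => hR (h2 _ h)
  simp only [Set.mem_ofPred_eq] at hz h3
  by_cases hzP : z ∈ P.support
  · exact fan_hit hadj hx hy P Q hP hQ hxy hPQ hPC hQC hwC hwP hwQ R' h1 hvR h3 hzP
  by_cases hzQ : z ∈ Q.support
  · exact fan_hit hadj hy hx Q P hQ hP hxy.symm hQP hQC hPC hwC hwQ hwP R' h1 hvR
      (fun u hu h => h3 u hu (by tauto)) hzQ
  have hzC : z ∈ C := by tauto
  exact fan_hitC hadj hx P hP hPC hwC hwP R' h1 (fun u hu h => h3 u hu (by tauto)) hzC hzP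

lemma fan_all {C : Set V} (hv : ∀ v, (G.induce {w : V | w ≠ v}).Connected)
    (h2 : ∀ c : V, ∃ d ∈ C, d ≠ c) {c s : V} (R : G.Walk s c) (hc : c ∈ C) (hs : s ∉ C) :
    HasFan G C s := by
  induction R with
  | nil => exact absurd hc hs
  | @cons a b e hab p ih =>
    by_cases hb : b ∈ C
    · obtain ⟨d, hd, hdb⟩ := h2 b
      exact fan_base (hv b) hb hd hdb hs hab.symm
    · exact fan_step (hv b) hb hs hab.symm (ih hc hb)

lemma not_path {u v : V} (p : G.Walk u v) (hp : ¬ p.IsPath) :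
    ∃ (x : V) (a : G.Walk u x) (b : G.Walk x x) (c : G.Walk x v),
      p.length = a.length + b.length + c.length ∧ 0 < b.length := by
  classical
  induction p with
  | nil => simp at hp
  | @cons u w v h q ih =>
    by_cases hq : q.IsPath
    · have hu : u ∈ q.support := by
        by_contra hu
        exact hp (by simp [hq, hu])
      obtain ⟨q1, q2, rfl⟩ := q.mem_support_iff_exists_append.1 hu
      refine ⟨u, .nil, .cons h q1, q2, ?_, by simp⟩
      simp; omega
    · obtain ⟨x, a, b, c, h1, h2⟩ := ih hq
      refine ⟨x, .cons h a, b, c, ?_, h2⟩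
      simp; omega

lemma odd_cycle : ∀ (n : ℕ) (u : V) (p : G.Walk u u), p.length = n → Odd n →
    ∃ (x : V) (c : G.Walk x x), c.IsCycle ∧ Odd c.length := by
  intro n
  induction n using Nat.strong_induction_on with
  | _ n ih =>
    intro u p hpn hn
    cases p with
    | nil => simp at hpn; subst hpn; simp at hn
    | @cons _ v _ h q =>
      simp only [Walk.length_cons] at hpn
      by_cases hq : q.IsPath
      · refine ⟨u, .cons h q, ?_, by simpa [hpn] using hn⟩
        have hl : q.length ≠ 1 := by
          intro h1
          rw [h1] at hpn
          subst hpn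
          exact absurd hn (by decide)
        have hl0 : 0 < q.length := by
          rcases Nat.eq_zero_or_pos q.length with h0 | h0
          · exact absurd (Walk.eq_of_length_eq_zero h0) h.ne'
          · exact h0
        rw [Walk.cons_isCycle_iff]
        refine ⟨hq, fun he => hl ?_⟩
        rw [Sym2.eq_swap] at he
        exact hq.length_eq_one_of_mem_edges he
      · obtain ⟨x, a, b, c, h1, h2⟩ := not_path q hq
        by_cases hb : Odd b.length
        · exact ih b.length (by omega) x b rfl hb
        · refine ih (n - b.length) (by omega) u (.cons h (a.append c)) ?_ ?_
          · simp; omega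
          · grind

lemma main (hG : G.Connected) (hv : ∀ v, (G.induce {w : V | w ≠ v}).Connected)
    {x0 : V} (c : G.Walk x0 x0) (hc : c.IsCycle) (hodd : Odd c.length) {s : V}
    (hs : s ∉ c.support) :
    ∃ (a : V) (d : G.Walk a a), d.IsCycle ∧ Even d.length ∧ s ∈ d.support := by
  classical
  have h2 : ∀ e : V, ∃ d ∈ {u | u ∈ c.support}, d ≠ e := by
    intro e
    by_cases he : x0 = e
    · exact ⟨c.snd, c.getVert_mem_support 1, he ▸ (c.adj_snd hc.not_nil).ne'⟩
    · exact ⟨x0, c.start_mem_support, he⟩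
  obtain ⟨R⟩ := hG.preconnected s x0
  obtain ⟨x, hx, y, hy, P, Q, hP, hQ, hxy, hPQ, hPC, hQC⟩ :=
    fan_all (C := {u | u ∈ c.support}) hv h2 R c.start_mem_support hs
  simp only [Set.mem_ofPred_eq] at hx hy hPC hQC
  have hc' : (c.rotate x hx).IsCycle := hc.rotate hx
  have hl' : (c.rotate x hx).length = c.length := by simp
  have hm' : ∀ u, u ∈ (c.rotate x hx).support ↔ u ∈ c.support := fun u => by simp
  generalize c.rotate x hx = c' at hc' hl' hm'
  obtain ⟨A, B, rfl⟩ := c'.mem_support_iff_exists_append.1 ((hm' y).2 hy)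
  have hB : B.IsPath := hc'.isPath_of_append_right (Walk.not_nil_of_ne hxy)
  have hA : A.IsPath := hc'.isPath_of_append_left (Walk.not_nil_of_ne hxy.symm)
  have hsx : s ≠ x := fun h => hs (h ▸ hx)
  have hsy : s ≠ y := fun h => hs (h ▸ hy)
  have hT : (P.reverse.append Q).IsPath :=
    append_path hP.reverse hQ (by simpa using hPQ)
  have hTs : s ∈ (P.reverse.append Q).support := by simp [Walk.mem_support_append_iff]
  have hPl : 0 < P.length := Nat.pos_of_ne_zero fun h => hsx (Walk.eq_of_length_eq_zero h)
  have hQl : 0 < Q.length := Nat.pos_of_ne_zero fun h => hsy (Walk.eq_of_length_eq_zero h)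
  have hTl : 1 < (P.reverse.append Q).length := by simp; omega
  have hTC : ∀ u ∈ (P.reverse.append Q).support, u ∈ c.support → u = x ∨ u = y := by
    intro u hu huc
    simp [Walk.mem_support_append_iff] at hu
    grind
  generalize P.reverse.append Q = T at hT hTs hTl hTC
  have key : ∀ D : G.Walk y x, D.IsPath → (∀ u ∈ D.support, u ∈ c.support) →
      (T.append D).IsCycle := by
    intro D hD hDc
    refine hT.isCycle_append hD ?_ (.inl hTl)
    intro u hu hu'
    have h1 := hT.support_nodup
    have h2 := hD.support_nodup
    rw [← Walk.cons_tail_support, List.nodup_cons] at h1 h2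
    rcases hTC u (List.mem_of_mem_tail hu) (hDc u (List.mem_of_mem_tail hu')) with rfl | rfl
    · exact h1.1 hu
    · exact h2.1 hu'
  have hAc : ∀ u ∈ A.reverse.support, u ∈ c.support := by
    intro u hu
    rw [← hm', Walk.mem_support_append_iff]
    left; simpa using hu
  have hBc : ∀ u ∈ B.support, u ∈ c.support := by
    intro u hu
    rw [← hm', Walk.mem_support_append_iff]
    right; exact hu
  rw [← hl', Walk.length_append] at hodd
  by_cases hpar : Even (T.length + B.length)
  · exact ⟨x, T.append B, key B hB hBc, by simpa using hpar,
      (Walk.mem_support_append_iff _ _).2 (.inl hTs)⟩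
  · refine ⟨x, T.append A.reverse, key _ hA.reverse hAc, ?_,
      (Walk.mem_support_append_iff _ _).2 (.inl hTs)⟩
    rw [Walk.length_append, Walk.length_reverse]
    grind

end Fan14

/-- If a 2-connected graph with `S ≠ ∅` contains no even `S`-cycle, then every connected
component of `G − S` is bipartite. -/
theorem stmt14 {V : Type*} [Fintype V] (G : SimpleGraph V)
    (hG : TwoConnected G) (S : Set V) (hS : S.Nonempty)
    (h : ¬ ∃ (a : V) (c : G.Walk a a), c.IsCycle ∧ Even c.length ∧ ∃ w ∈ S, w ∈ c.support) :
    ∀ C : (G.induce Sᶜ).ConnectedComponent,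
      ((G.induce Sᶜ).induce C.supp).Colorable 2 := by
  intro C
  obtain ⟨s, hs⟩ := hS
  suffices hcol : (G.induce Sᶜ).Colorable 2 from
    hcol.of_hom (SimpleGraph.Embedding.induce C.supp).toHom
  rw [two_colorable_iff_forall_loop_even]
  intro u p
  by_contra hp
  rw [Nat.not_even_iff_odd] at hp
  obtain ⟨x, c, hc, hodd⟩ := Fan14.odd_cycle _ u p rfl hp
  have hinj : Function.Injective (SimpleGraph.Embedding.induce (G := G) Sᶜ).toHom :=
    (SimpleGraph.Embedding.induce (G := G) Sᶜ).injective
  obtain ⟨a, d, hd, he, hsd⟩ := Fan14.main hG.2.1 hG.2.2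
    (c.map (SimpleGraph.Embedding.induce (G := G) Sᶜ).toHom)
    ((Walk.isCycle_map_iff_of_injective hinj).2 hc) (by rw [Walk.length_map]; exact hodd) (s := s) (by
      rw [Walk.support_map]
      intro hmem
      obtain ⟨y, _, hy⟩ := List.mem_map.1 hmem
      exact y.2 (by
        have : (y : V) = s := hy
        rw [this]; exact hs))
  exact h ⟨a, d, hd, he, s, hs, hsd⟩
end

section
/- Let G be a 2-connected finite simple graph on vertex set V with |V| ≥ 3, and let S ⊆ V be nonempty. If G contains no even S-cycle, then for every connected component A of G − S, exactly two edges of G have exactly one endpoint in A. -/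
open SimpleGraph

namespace Aux15

variable {V : Type*} {G : SimpleGraph V}

lemma isPath_append {u v w : V} {p : G.Walk u v} {q : G.Walk v w} (hp : p.IsPath) (hq : q.IsPath)
    (h : ∀ z, z ∈ p.support → z ∈ q.support → z = v) : (p.append q).IsPath := by
  rw [Walk.isPath_def, Walk.support_append, List.nodup_append']
  refine ⟨hp.support_nodup, hq.support_nodup.tail, ?_⟩
  intro z hz hz'
  have h1 := h z hz (List.mem_of_mem_tail hz')
  subst h1
  have := hq.support_nodup
  rw [← Walk.cons_tail_support, List.nodup_cons] at this
  exact this.1 hz'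

lemma split_path {u v w : V} {p : G.Walk u v} (hp : p.IsPath) (hw : w ∈ p.support) :
    ∃ (q : G.Walk u w) (r : G.Walk w v), q.IsPath ∧ r.IsPath ∧
      (∀ z, z ∈ p.support ↔ z ∈ q.support ∨ z ∈ r.support) ∧
      (∀ z, z ∈ q.support → z ∈ r.support → z = w) := by
  obtain ⟨q, r, hq, hr, rfl⟩ := hp.mem_support_iff_exists_append.1 hw
  refine ⟨q, r, hq, hr, fun z => Walk.mem_support_append_iff _ _, fun z h1 h2 => ?_⟩
  by_contra hne
  exact hp.ne_of_mem_support_of_append hne h1 h2 rfl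

lemma cycle_of {u v : V} {p q : G.Walk u v} (hp : p.IsPath) (hq : q.IsPath)
    (h : ∀ z, z ∈ p.support → z ∈ q.support → z = u ∨ z = v)
    (hl : 1 < p.length ∨ 1 < q.length) : (p.append q.reverse).IsCycle := by
  refine hp.isCycle_append hq.reverse ?_ (by simpa using hl)
  intro z h1 h2
  have h3 := hp.support_nodup
  rw [← Walk.cons_tail_support, List.nodup_cons] at h3
  have h4 := hq.reverse.support_nodup
  rw [← Walk.cons_tail_support, List.nodup_cons] at h4
  have h5 : z ∈ q.support := by simpa using List.mem_of_mem_tail h2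
  rcases h z (List.mem_of_mem_tail h1) h5 with rfl | rfl
  · exact h3.1 h1
  · exact h4.1 h2

lemma split_cycle {x a b : V} {c : G.Walk x x} (hc : c.IsCycle) (ha : a ∈ c.support)
    (hb : b ∈ c.support) (hab : a ≠ b) :
    ∃ p q : G.Walk a b, p.IsPath ∧ q.IsPath ∧
      (∀ z, z ∈ c.support ↔ z ∈ p.support ∨ z ∈ q.support) ∧
      (∀ z, z ∈ p.support → z ∈ q.support → z = a ∨ z = b) ∧
      (1 < p.length ∨ 1 < q.length) := by
  classical
  have hc' := hc.rotate ha
  have hm : ∀ z, z ∈ (c.rotate a ha).support ↔ z ∈ c.support :=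
    fun z => Walk.mem_support_rotate_iff c a ha
  generalize c.rotate a ha = d at hc' hm
  obtain ⟨p, q, rfl⟩ := Walk.mem_support_iff_exists_append.1 ((hm b).2 hb)
  refine ⟨p, q.reverse, hc'.isPath_of_append_left (Walk.not_nil_of_ne hab.symm), ?_, ?_, ?_, ?_⟩
  · rw [Walk.isPath_reverse_iff]
    exact hc'.isPath_of_append_right (Walk.not_nil_of_ne hab)
  · intro z
    rw [← hm, Walk.mem_support_append_iff]
    simp
  · intro z h1 h2
    have h2 : z ∈ q.support := by simpa using h2
    have hn := hc'.support_nodup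
    rw [Walk.tail_support_append, List.nodup_append'] at hn
    by_contra hcon
    rw [not_or] at hcon
    rw [Walk.mem_support_iff] at h1 h2
    exact hn.2.2 (h1.resolve_left hcon.1) (h2.resolve_left hcon.2)
  · have := hc'.three_le_length
    simp only [Walk.length_append, Walk.length_reverse] at this ⊢
    omega

/-- No even cycle meeting `S`. -/
def NoEven (G : SimpleGraph V) (S : Set V) : Prop :=
  ¬ ∃ (a : V) (c : G.Walk a a), c.IsCycle ∧ Even c.length ∧ ∃ w ∈ S, w ∈ c.support

lemma pair_odd {S : Set V} (h : NoEven G S) {u v : V} {p q : G.Walk u v}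
    (hp : p.IsPath) (hq : q.IsPath)
    (hd : ∀ z, z ∈ p.support → z ∈ q.support → z = u ∨ z = v)
    (hl : 1 < p.length ∨ 1 < q.length)
    (hs : ∃ s ∈ S, s ∈ p.support ∨ s ∈ q.support) : ¬ Even (p.length + q.length) := by
  intro he
  refine h ⟨u, _, cycle_of hp hq hd hl, by simpa using he, ?_⟩
  obtain ⟨s, hs, h1⟩ := hs
  exact ⟨s, hs, by simpa [Walk.mem_support_append_iff] using h1⟩

lemma one_lt_length {u v z : V} {p : G.Walk u v} (hz : z ∈ p.support) (h1 : z ≠ u) (h2 : z ≠ v) :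
    1 < p.length := by
  cases p with
  | nil => simp_all
  | cons a p =>
    cases p with
    | nil => simp_all
    | cons b p => simp

lemma first_hit {u v : V} (p : G.Walk u v) (T : Set V) (hv : v ∈ T) :
    ∃ z ∈ T, ∃ r : G.Walk u z, r.IsPath ∧ (∀ x ∈ r.support, x ∈ p.support) ∧
      ∀ x ∈ r.support, x ∈ T → x = z := by
  classical
  suffices H : ∃ z ∈ T, ∃ r : G.Walk u z, (∀ x ∈ r.support, x ∈ p.support) ∧
      ∀ x ∈ r.support, x ∈ T → x = z by
    obtain ⟨z, hz, r, h1, h2⟩ := H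
    refine ⟨z, hz, r.bypass, r.bypass_isPath, fun x hx => ?_, fun x hx => ?_⟩
    · exact h1 x (r.support_bypass_subset_support hx)
    · exact h2 x (r.support_bypass_subset_support hx)
  induction p with
  | nil => exact ⟨_, hv, Walk.nil, by simp, by simp⟩
  | @cons a b c hab p ih =>
    by_cases ha : a ∈ T
    · exact ⟨a, ha, Walk.nil, by simp, by simp⟩
    · obtain ⟨z, hz, r, h1, h2⟩ := ih hv
      refine ⟨z, hz, Walk.cons hab r, ?_, ?_⟩
      · intro x hx
        simp only [Walk.support_cons, List.mem_cons] at hx ⊢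
        exact hx.imp id (h1 x)
      · intro x hx hxT
        simp only [Walk.support_cons, List.mem_cons] at hx
        rcases hx with rfl | hx
        · exact absurd hxT ha
        · exact h2 x hx hxT

/-- Joined by a walk inside `T`. -/
def Conn (G : SimpleGraph V) (T : Set V) (x y : V) : Prop :=
  ∃ p : G.Walk x y, ∀ z ∈ p.support, z ∈ T

lemma spider {T : Set V} {x y w : V} (h1 : Conn G T x y) (h2 : Conn G T w x) :
    ∃ t ∈ T, ∃ (p : G.Walk t x) (q : G.Walk t y) (r : G.Walk t w),
      p.IsPath ∧ q.IsPath ∧ r.IsPath ∧ (∀ z ∈ p.support, z ∈ T) ∧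
      (∀ z ∈ q.support, z ∈ T) ∧ (∀ z ∈ r.support, z ∈ T) ∧
      (∀ z, z ∈ p.support → z ∈ q.support → z = t) ∧
      (∀ z, z ∈ p.support → z ∈ r.support → z = t) ∧
      (∀ z, z ∈ q.support → z ∈ r.support → z = t) := by
  classical
  obtain ⟨a, ha⟩ := h1
  obtain ⟨b, hb⟩ := h2
  have ha' : ∀ z ∈ a.bypass.support, z ∈ T := fun z hz => ha z (a.support_bypass_subset_support hz)
  obtain ⟨t, ht, r, hr, hrb, hrt⟩ := first_hit b {z | z ∈ a.bypass.support} (by simp)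
  obtain ⟨p, q, hp, hq, hpq, hd⟩ := split_path a.bypass_isPath ht
  simp only [Set.mem_ofPred_eq] at hrt
  refine ⟨t, ha' t ht, p.reverse, q, r.reverse, hp.reverse, hq, hr.reverse, ?_, ?_, ?_, ?_, ?_, ?_⟩
    <;> try simp only [Walk.support_reverse, List.mem_reverse]
  · exact fun z hz => ha' z ((hpq z).2 (Or.inl hz))
  · exact fun z hz => ha' z ((hpq z).2 (Or.inr hz))
  · exact fun z hz => hb z (hrb z hz)
  · exact hd
  · exact fun z hz hz' => hrt z hz' ((hpq z).2 (Or.inl hz))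
  · exact fun z hz hz' => hrt z hz' ((hpq z).2 (Or.inr hz))

/-- Two walks from `v` to `X` disjoint except at `v`. -/
def IsFan (X : Set V) {v a b : V} (p : G.Walk v a) (q : G.Walk v b) : Prop :=
  a ≠ b ∧ a ∈ X ∧ b ∈ X ∧ p.IsPath ∧ q.IsPath ∧ (∀ z ∈ p.support, z ∈ X → z = a) ∧
    (∀ z ∈ q.support, z ∈ X → z = b) ∧ (∀ z, z ∈ p.support → z ∈ q.support → z = v)

lemma IsFan.symm {X : Set V} {v a b : V} {p : G.Walk v a} {q : G.Walk v b} (h : IsFan X p q) :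
    IsFan X q p := by
  obtain ⟨h1, h2, h3, h4, h5, h6, h7, h8⟩ := h
  exact ⟨h1.symm, h3, h2, h5, h4, h7, h6, fun z a b => h8 z b a⟩

def HasFan (G : SimpleGraph V) (X : Set V) (v : V) : Prop :=
  ∃ (a b : V) (p : G.Walk v a) (q : G.Walk v b), IsFan X p q

/-- reroute: `r` from `v` hits `p` first at `z`. -/
lemma reroute {X : Set V} {v w a b z : V} {p : G.Walk w a} {q : G.Walk w b} (h : IsFan X p q)
    (hvw : G.Adj v w) (hv : v ∉ X) (hvq : v ∉ q.support) (hw : w ∉ X)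
    (r : G.Walk v z) (hr : r.IsPath) (hzp : z ∈ p.support) (hzw : z ≠ w)
    (hr' : ∀ x ∈ r.support, (x ∈ X ∨ x ∈ p.support ∨ x ∈ q.support) → x = z) : HasFan G X v := by
  obtain ⟨h1, h2, h3, h4, h5, h6, h7, h8⟩ := h
  obtain ⟨p1, p2, hp1, hp2, hp, hd⟩ := split_path h4 hzp
  have hzq : z ∉ q.support := fun hh => hzw (h8 z hzp hh)
  refine ⟨a, b, r.append p2, Walk.cons hvw q, h1, h2, h3, ?_, ?_, ?_, ?_, ?_⟩
  · refine isPath_append hr hp2 fun x hx hx' => hr' x hx (Or.inr (Or.inl ((hp x).2 (Or.inr hx'))))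
  · exact (Walk.cons_isPath_iff _ _).2 ⟨h5, hvq⟩
  · intro x hx hxX
    rw [Walk.mem_support_append_iff] at hx
    rcases hx with hx | hx
    · have := hr' x hx (Or.inl hxX)
      subst this
      exact h6 x hzp hxX
    · exact h6 x ((hp x).2 (Or.inr hx)) hxX
  · intro x hx hxX
    rw [Walk.support_cons, List.mem_cons] at hx
    rcases hx with rfl | hx
    · exact absurd hxX hv
    · exact h7 x hx hxX
  · intro x hx hx'
    rw [Walk.mem_support_append_iff] at hx
    rw [Walk.support_cons, List.mem_cons] at hx'
    rcases hx' with rfl | hx'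
    · rfl
    · exfalso
      rcases hx with hx | hx
      · have := hr' x hx (Or.inr (Or.inr hx'))
        subst this
        exact hzq hx'
      · have := h8 x ((hp x).2 (Or.inr hx)) hx'
        subst this
        exact hzw (hd x p1.start_mem_support hx).symm

lemma fan_step (h2 : ∀ w x y : V, x ≠ w → y ≠ w → Conn G {z | z ≠ w} x y) {X : Set V}
    (hX : ∀ w, ∃ y ∈ X, y ≠ w) {v w : V} (hvw : G.Adj v w) (hw : w ∈ X ∨ HasFan G X w) :
    v ∈ X ∨ HasFan G X v := by
  classical
  by_cases hv : v ∈ X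
  · exact Or.inl hv
  right
  by_cases hwX : w ∈ X
  · obtain ⟨y, hy, hyw⟩ := hX w
    obtain ⟨p, hp⟩ := h2 w v y hvw.ne hyw
    obtain ⟨z, hz, r, hr, hrp, hrz⟩ := first_hit p X hy
    have hwr : w ∉ r.support := fun hh => hp w (hrp w hh) rfl
    refine ⟨z, w, r, Walk.cons hvw Walk.nil, ?_, hz, hwX, hr, ?_, hrz, ?_, ?_⟩
    · rintro rfl; exact hwr r.end_mem_support
    · simp [hvw.ne]
    · simp only [Walk.support_cons, Walk.support_nil, List.mem_cons, List.not_mem_nil, or_false]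
      rintro x (rfl | rfl) hx
      · exact absurd hx hv
      · rfl
    · simp only [Walk.support_cons, Walk.support_nil, List.mem_cons, List.not_mem_nil, or_false]
      rintro x hx (rfl | rfl)
      · rfl
      · exact absurd hx hwr
  · obtain ⟨a, b, p, q, hf⟩ := hw.resolve_left hwX
    have haX := hf.2.1
    have haw : a ≠ w := by rintro rfl; exact hwX haX
    obtain ⟨s, hs⟩ := h2 w v a hvw.ne haw
    obtain ⟨z, hz, r, hr, hrp, hrz⟩ := first_hit s {x | x ∈ X ∨ x ∈ p.support ∨ x ∈ q.support}
      (Or.inl haX)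
    simp only [Set.mem_ofPred_eq] at hrz hz
    have hwr : w ∉ r.support := fun hh => hs w (hrp w hh) rfl
    have hzw : z ≠ w := by rintro rfl; exact hwr r.end_mem_support
    by_cases hvp : v ∈ p.support
    · have hvz := hrz v r.start_mem_support (Or.inr (Or.inl hvp))
      subst hvz
      exact reroute hf hvw hv (fun hh => hvw.ne (hf.2.2.2.2.2.2.2 v hvp hh)) hwX r hr hvp hzw hrz
    by_cases hvq : v ∈ q.support
    · have hvz := hrz v r.start_mem_support (Or.inr (Or.inr hvq))
      subst hvz
      exact reroute hf.symm hvw hv (fun hh => hvw.ne (hf.2.2.2.2.2.2.2 v hh hvq)) hwX r hr hvq hzw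
        (fun x hx hx' => hrz x hx (by tauto))
    by_cases hzp : z ∈ p.support
    · exact reroute hf hvw hv hvq hwX r hr hzp hzw hrz
    by_cases hzq : z ∈ q.support
    · exact reroute hf.symm hvw hv hvp hwX r hr hzq hzw (fun x hx hx' => hrz x hx (by tauto))
    have hzX : z ∈ X := by tauto
    obtain ⟨g1, g2, g3, g4, g5, g6, g7, g8⟩ := hf
    refine ⟨z, a, r, Walk.cons hvw p, ?_, hzX, haX, hr, ?_, ?_, ?_, ?_⟩
    · rintro rfl; exact hzp p.end_mem_support
    · exact (Walk.cons_isPath_iff _ _).2 ⟨g4, hvp⟩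
    · exact fun x hx hx' => hrz x hx (Or.inl hx')
    · intro x hx hxX
      rw [Walk.support_cons, List.mem_cons] at hx
      rcases hx with rfl | hx
      · exact absurd hxX hv
      · exact g6 x hx hxX
    · intro x hx hx'
      rw [Walk.support_cons, List.mem_cons] at hx'
      rcases hx' with rfl | hx'
      · rfl
      · have := hrz x hx (Or.inr (Or.inl hx'))
        subst this
        exact absurd hx' hzp

lemma fan (h1 : G.Connected) (h2 : ∀ w x y : V, x ≠ w → y ≠ w → Conn G {z | z ≠ w} x y) {X : Set V}
    (hX : ∀ w, ∃ y ∈ X, y ≠ w) (v : V) (hv : v ∉ X) : HasFan G X v := by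
  obtain ⟨y, hy, -⟩ := hX v
  obtain ⟨p⟩ := h1.preconnected v y
  have : v ∈ X ∨ HasFan G X v := by
    clear hv
    induction p with
    | nil => exact Or.inl hy
    | cons hab p ih => exact fan_step h2 hX hab (ih hy)
  exact this.resolve_left hv

/-- Every `S`-cycle contains all of `S`. -/
lemma cycle_all (h1 : G.Connected) (h2 : ∀ w x y : V, x ≠ w → y ≠ w → Conn G {z | z ≠ w} x y)
    {S : Set V} (hS : NoEven G S) {u v : V} {p q : G.Walk u v} (hp : p.IsPath) (hq : q.IsPath)
    (hd : ∀ z, z ∈ p.support → z ∈ q.support → z = u ∨ z = v)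
    (hl : 1 < p.length ∨ 1 < q.length) {s s' : V} (hs : s ∈ S) (hs' : s' ∈ S)
    (hsp : s ∈ p.support ∨ s ∈ q.support) : s' ∈ p.support ∨ s' ∈ q.support := by
  classical
  by_contra hcon
  have hc := cycle_of hp hq hd hl
  set c := p.append q.reverse with hcdef
  have hcs : ∀ z, z ∈ c.support ↔ z ∈ p.support ∨ z ∈ q.support := by
    intro z; simp [hcdef, Walk.mem_support_append_iff]
  rw [← hcs] at hcon hsp
  have huv : u ≠ v := by
    rintro rfl
    have e1 := Walk.isPath_iff_nil.1 hp
    have e2 := Walk.isPath_iff_nil.1 hq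
    have e3 := e1.length_eq_zero
    have e4 := e2.length_eq_zero
    omega
  obtain ⟨a, b, f, g, hab, ha, hb, hf, hg, hfX, hgX, hfg⟩ :=
    fan h1 h2 (X := {z | z ∈ c.support}) (fun w => by
      by_cases hw : u = w
      · exact ⟨v, (hcs v).2 (Or.inl p.end_mem_support), by rintro rfl; exact huv hw⟩
      · exact ⟨u, (hcs u).2 (Or.inl p.start_mem_support), hw⟩) s' hcon
  simp only [Set.mem_ofPred_eq] at ha hb hfX hgX
  have hsa : s' ≠ a := by rintro rfl; exact hcon ha
  have hsb : s' ≠ b := by rintro rfl; exact hcon hb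
  obtain ⟨p', q', hp', hq', hpq, hd', hl'⟩ := split_cycle hc ha hb hab
  have he : (f.reverse.append g).IsPath := by
    refine isPath_append hf.reverse hg fun z hz hz' => hfg z ?_ hz'
    simpa using hz
  have hes : s' ∈ (f.reverse.append g).support := by
    rw [Walk.mem_support_append_iff]
    exact Or.inr g.start_mem_support
  have hel : 1 < (f.reverse.append g).length := one_lt_length hes hsa hsb
  have hed : ∀ z, z ∈ (f.reverse.append g).support → z ∈ c.support → z = a ∨ z = b := by
    intro z hz hzc
    rw [Walk.mem_support_append_iff, Walk.support_reverse, List.mem_reverse] at hz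
    exact hz.imp (fun h => hfX z h hzc) (fun h => hgX z h hzc)
  generalize f.reverse.append g = e at he hes hel hed
  have o1 := pair_odd hS hp' hq' hd' hl' ⟨s, hs, (hpq s).1 hsp⟩
  have o2 := pair_odd hS he hp' (fun z hz hz' => hed z hz ((hpq z).2 (Or.inl hz'))) (Or.inl hel)
    ⟨s', hs', Or.inl hes⟩
  have o3 := pair_odd hS he hq' (fun z hz hz' => hed z hz ((hpq z).2 (Or.inr hz'))) (Or.inl hel)
    ⟨s', hs', Or.inl hes⟩
  rw [Nat.even_iff] at o1 o2 o3
  omega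

lemma connOut (h1 : G.Connected) (h2 : ∀ w x y : V, x ≠ w → y ≠ w → Conn G {z | z ≠ w} x y)
    {S : Set V} (hS : NoEven G S) {A : Set V} (hA : ∀ x ∈ A, ∀ y ∈ A, Conn G A x y)
    (hne : A.Nonempty) (hAS : ∀ x ∈ A, x ∉ S) {s s' : V} (hs : s ∈ S) (hs' : s' ∈ S) :
    Conn G Aᶜ s s' := by
  classical
  have hsA : s ∉ A := fun hh => hAS s hh hs
  have hsA' : s' ∉ A := fun hh => hAS s' hh hs'
  by_contra hcon
  have hX : ∀ w, ∃ y ∈ A, y ≠ w := by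
    intro w
    by_contra hw
    push Not at hw
    obtain ⟨x, hx⟩ := hne
    have hxw := hw x hx
    subst hxw
    obtain ⟨p, hp⟩ := h2 x s s' (by rintro rfl; exact hsA hx) (by rintro rfl; exact hsA' hx)
    exact hcon ⟨p, fun z hz hzA => hp z hz (hw z hzA)⟩
  obtain ⟨a, b, f, g, hab, ha, hb, hf, hg, hfX, hgX, hfg⟩ := fan h1 h2 hX s hsA
  have key : ∀ {a : V} {f : G.Walk s a}, f.IsPath → (∀ z ∈ f.support, z ∈ A → z = a) → a ∈ A →
      s' ∉ f.support := by
    intro a f hf hfX ha hsf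
    obtain ⟨f1, f2, hf1, hf2, hff, hd⟩ := split_path hf hsf
    refine hcon ⟨f1, fun z hz hzA => ?_⟩
    have := hfX z ((hff z).2 (Or.inl hz)) hzA
    subst this
    have := hd z hz f2.end_mem_support
    subst this
    exact hsA' hzA
  obtain ⟨k0, hk0⟩ := hA a ha b hb
  have hk : ∀ z ∈ k0.bypass.support, z ∈ A :=
    fun z hz => hk0 z (k0.support_bypass_subset_support hz)
  have hkp := k0.bypass_isPath
  generalize k0.bypass = k at hk hkp
  have hP : (f.append k).IsPath := isPath_append hf hkp fun z hz hz' => hfX z hz (hk z hz')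
  have hl : 1 < (f.append k).length := by
    refine one_lt_length (z := a) ?_ (by rintro rfl; exact hsA ha) hab
    rw [Walk.mem_support_append_iff]
    exact Or.inl f.end_mem_support
  have := cycle_all h1 h2 hS hP hg (fun z hz hz' => by
    rw [Walk.mem_support_append_iff] at hz
    rcases hz with hz | hz
    · exact Or.inl (hfg z hz hz')
    · exact Or.inr (hgX z hz' (hk z hz))) (Or.inl hl) hs hs' (Or.inr g.start_mem_support)
  rw [Walk.mem_support_append_iff] at this
  rcases this with (h3 | h3) | h3
  · exact key hf hfX ha h3
  · exact hsA' (hk _ h3)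
  · exact key hg hgX hb h3

lemma leg {A : Set V} {t x t' s : V} {p : G.Walk t x} {q : G.Walk t' s} (hp : p.IsPath)
    (hq : q.IsPath) (hpA : ∀ z ∈ p.support, z ∈ A) (hqA : ∀ z ∈ q.support, z ∈ Aᶜ)
    (hxs : G.Adj x s) : ∃ r : G.Walk t t', r.IsPath ∧
      (∀ z, z ∈ r.support ↔ z ∈ p.support ∨ z ∈ q.support) ∧
      r.length = p.length + 1 + q.length := by
  refine ⟨p.append (Walk.cons hxs q.reverse), ?_, ?_, ?_⟩
  · refine isPath_append hp ((Walk.cons_isPath_iff _ _).2 ⟨hq.reverse, ?_⟩) ?_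
    · intro hx
      exact hqA x (by simpa using hx) (hpA x p.end_mem_support)
    · intro z hz hz'
      rw [Walk.support_cons, List.mem_cons] at hz'
      rcases hz' with rfl | hz'
      · rfl
      · exact absurd (hpA z hz) (hqA z (by simpa using hz'))
  · intro z
    rw [Walk.mem_support_append_iff, Walk.support_cons, List.mem_cons, Walk.support_reverse,
      List.mem_reverse]
    constructor
    · rintro (h | rfl | h)
      · exact Or.inl h
      · exact Or.inl p.end_mem_support
      · exact Or.inr h
    · tauto
  · simp only [Walk.length_append, Walk.length_cons, Walk.length_reverse]
    omega

lemma leg_pair {S A : Set V} (hS : NoEven G S) {t x y t' s s' : V}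
    {p : G.Walk t x} {q : G.Walk t' s} {p' : G.Walk t y} {q' : G.Walk t' s'}
    (hpA : ∀ z ∈ p.support, z ∈ A) (hqA : ∀ z ∈ q.support, z ∈ Aᶜ)
    (hpA' : ∀ z ∈ p'.support, z ∈ A) (hqA' : ∀ z ∈ q'.support, z ∈ Aᶜ)
    (hpp : ∀ z, z ∈ p.support → z ∈ p'.support → z = t)
    (hqq : ∀ z, z ∈ q.support → z ∈ q'.support → z = t')
    (hs : s ∈ S) (hne : s(x, s) ≠ s(y, s'))
    {r r' : G.Walk t t'} (hr : r.IsPath) (hr' : r'.IsPath)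
    (hrs : ∀ z, z ∈ r.support ↔ z ∈ p.support ∨ z ∈ q.support)
    (hrs' : ∀ z, z ∈ r'.support ↔ z ∈ p'.support ∨ z ∈ q'.support)
    (hl : r.length = p.length + 1 + q.length) (hl' : r'.length = p'.length + 1 + q'.length) :
    ¬ Even (r.length + r'.length) := by
  refine pair_odd hS hr hr' ?_ ?_ ⟨s, hs, Or.inl ((hrs s).2 (Or.inr q.end_mem_support))⟩
  · intro z hz hz'
    rw [hrs] at hz
    rw [hrs'] at hz'
    rcases hz with hz | hz <;> rcases hz' with hz' | hz'
    · exact Or.inl (hpp z hz hz')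
    · exact absurd (hpA z hz) (hqA' z hz')
    · exact absurd (hpA' z hz') (hqA z hz)
    · exact Or.inr (hqq z hz hz')
  · by_contra hcon
    have a1 : p.length = 0 := by omega
    have a2 : q.length = 0 := by omega
    have a3 : p'.length = 0 := by omega
    have a4 : q'.length = 0 := by omega
    have b1 := Walk.eq_of_length_eq_zero a1
    have b2 := Walk.eq_of_length_eq_zero a2
    have b3 := Walk.eq_of_length_eq_zero a3
    have b4 := Walk.eq_of_length_eq_zero a4
    exact hne (by rw [← b1, ← b2, ← b3, ← b4])

lemma three (h1 : G.Connected) (h2 : ∀ w x y : V, x ≠ w → y ≠ w → Conn G {z | z ≠ w} x y)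
    {S : Set V} (hS : NoEven G S) {A : Set V} (hA : ∀ x ∈ A, ∀ y ∈ A, Conn G A x y)
    (hAS : ∀ x ∈ A, x ∉ S) {x y w s s' s'' : V} (hx : x ∈ A) (hy : y ∈ A) (hw : w ∈ A)
    (hs : s ∈ S) (hs' : s' ∈ S) (hs'' : s'' ∈ S) (ex : G.Adj x s) (ey : G.Adj y s')
    (ew : G.Adj w s'') (n1 : s(x, s) ≠ s(y, s')) (n2 : s(x, s) ≠ s(w, s''))
    (n3 : s(y, s') ≠ s(w, s'')) : False := by
  obtain ⟨t, -, p1, p2, p3, hp1, hp2, hp3, i1, i2, i3, d12, d13, d23⟩ :=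
    spider (hA x hx y hy) (hA w hw x hx)
  obtain ⟨t', -, q1, q2, q3, hq1, hq2, hq3, j1, j2, j3, e12, e13, e23⟩ :=
    spider (connOut h1 h2 hS hA ⟨x, hx⟩ hAS hs hs') (connOut h1 h2 hS hA ⟨x, hx⟩ hAS hs'' hs)
  obtain ⟨r1, hr1, k1, l1⟩ := leg hp1 hq1 i1 j1 ex
  obtain ⟨r2, hr2, k2, l2⟩ := leg hp2 hq2 i2 j2 ey
  obtain ⟨r3, hr3, k3, l3⟩ := leg hp3 hq3 i3 j3 ew
  have o1 := leg_pair hS i1 j1 i2 j2 d12 e12 hs n1 hr1 hr2 k1 k2 l1 l2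
  have o2 := leg_pair hS i1 j1 i3 j3 d13 e13 hs n2 hr1 hr3 k1 k3 l1 l3
  have o3 := leg_pair hS i2 j2 i3 j3 d23 e23 hs' n3 hr2 hr3 k2 k3 l2 l3
  rw [Nat.even_iff] at o1 o2 o3
  omega

lemma conn_of_induce {T : Set V} {x y : T} (p : (G.induce T).Walk x y) :
    ∃ q : G.Walk x.1 y.1, ∀ z ∈ q.support, ∃ h : z ∈ T, (⟨z, h⟩ : T) ∈ p.support := by
  induction p with
  | nil => exact ⟨Walk.nil, by simp⟩
  | @cons a b c hab p ih =>
    obtain ⟨q, hq⟩ := ih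
    refine ⟨Walk.cons (show G.Adj a.1 b.1 from hab) q, ?_⟩
    intro z hz
    rw [Walk.support_cons, List.mem_cons] at hz
    rcases hz with rfl | hz
    · exact ⟨a.2, by simp⟩
    · obtain ⟨h, hmem⟩ := hq z hz
      exact ⟨h, by simp [hmem]⟩

/-- A walk from inside `A` to outside `A` contains a boundary edge. -/
lemma cross {A T : Set V} {x y : V} (h : Conn G T x y) (hx : x ∈ A) (hy : y ∉ A) :
    ∃ a b, G.Adj a b ∧ a ∈ A ∧ b ∉ A ∧ a ∈ T ∧ b ∈ T := by
  obtain ⟨p, hp⟩ := h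
  obtain ⟨d, hd, h1, h2⟩ := p.exists_boundary_dart A hx hy
  exact ⟨d.fst, d.snd, d.adj, h1, h2, hp _ (p.dart_fst_mem_support_of_mem_darts hd),
    hp _ (p.dart_snd_mem_support_of_mem_darts hd)⟩

end Aux15

theorem stmt15 {V : Type*} [Fintype V] (G : SimpleGraph V)
    (hG : TwoConnected G) (S : Set V) (hS : S.Nonempty)
    (h : ¬ ∃ (a : V) (c : G.Walk a a), c.IsCycle ∧ Even c.length ∧ ∃ w ∈ S, w ∈ c.support) :
    ∀ C : (G.induce Sᶜ).ConnectedComponent,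
      {e ∈ G.edgeSet | ∃ x y : V, e = s(x, y) ∧
        x ∈ Subtype.val '' C.supp ∧ y ∉ Subtype.val '' C.supp}.ncard = 2 := by
  intro C
  have h1 := hG.2.1
  have h2 : ∀ w x y : V, x ≠ w → y ≠ w → Aux15.Conn G {z | z ≠ w} x y := by
    intro w x y hx hy
    obtain ⟨p⟩ := (hG.2.2 w).preconnected ⟨x, hx⟩ ⟨y, hy⟩
    obtain ⟨q, hq⟩ := Aux15.conn_of_induce p
    exact ⟨q, fun z hz => (hq z hz).1⟩
  have hA : ∀ x ∈ Subtype.val '' C.supp, ∀ y ∈ Subtype.val '' C.supp,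
      Aux15.Conn G (Subtype.val '' C.supp) x y := by
    rintro _ ⟨x, hx, rfl⟩ _ ⟨y, hy, rfl⟩
    rw [ConnectedComponent.mem_supp_iff] at hx hy
    obtain ⟨p⟩ := ConnectedComponent.eq.1 (hx.trans hy.symm)
    obtain ⟨q, hq⟩ := Aux15.conn_of_induce p
    refine ⟨q, fun z hz => ?_⟩
    obtain ⟨hz1, hz2⟩ := hq z hz
    refine ⟨⟨z, hz1⟩, ?_, rfl⟩
    rw [ConnectedComponent.mem_supp_iff, ← hx]
    classical
    exact ConnectedComponent.eq.2 ⟨(p.takeUntil _ hz2).reverse⟩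
  have hAS : ∀ x ∈ Subtype.val '' C.supp, x ∉ S := by
    rintro _ ⟨x, hx, rfl⟩
    exact x.2
  have hbd : ∀ x y : V, x ∈ Subtype.val '' C.supp → y ∉ Subtype.val '' C.supp → G.Adj x y →
      y ∈ S := by
    rintro _ y ⟨x, hx, rfl⟩ hy hxy
    by_contra hyS
    refine hy ⟨⟨y, hyS⟩, ?_, rfl⟩
    rw [ConnectedComponent.mem_supp_iff] at hx ⊢
    rw [← hx]
    exact ConnectedComponent.eq.2 (Adj.reachable (show (G.induce Sᶜ).Adj ⟨y, hyS⟩ x from hxy.symm))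
  have hne : (Subtype.val '' C.supp).Nonempty := C.nonempty_supp.image _
  generalize Subtype.val '' C.supp = A at *
  apply le_antisymm
  · by_contra hcon
    rw [not_le, Set.two_lt_ncard_iff (Set.toFinite _)] at hcon
    obtain ⟨a, b, c, ⟨ha, x, s, rfl, hx, hs⟩, ⟨hb, y, s', rfl, hy, hs'⟩,
      ⟨hc, w, s'', rfl, hw, hs''⟩, n1, n2, n3⟩ := hcon
    rw [mem_edgeSet] at ha hb hc
    exact Aux15.three h1 h2 h hA hAS hx hy hw (hbd _ _ hx hs ha) (hbd _ _ hy hs' hb)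
      (hbd _ _ hw hs'' hc) ha hb hc n1 n2 n3
  · obtain ⟨a, ha⟩ := hne
    obtain ⟨s, hs⟩ := hS
    have hsA : s ∉ A := fun hh => hAS s hh hs
    obtain ⟨p⟩ := h1.preconnected a s
    obtain ⟨x, y, hxy, hx, hy, -, -⟩ := Aux15.cross (T := Set.univ) ⟨p, by simp⟩ ha hsA
    have hother : ∃ x' y', G.Adj x' y' ∧ x' ∈ A ∧ y' ∉ A ∧ (x' ≠ x ∨ y' ≠ y) := by
      obtain ⟨z, hzx, hzy⟩ : ∃ z, z ≠ x ∧ z ≠ y := by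
        classical
        have : ({x, y} : Finset V).card < Fintype.card V := by
          have := hG.1
          have := Finset.card_le_two (a := x) (b := y)
          omega
        obtain ⟨z, hz⟩ := Finset.exists_mem_notMem_of_card_lt_card
          (s := {x, y}) (t := Finset.univ) (by simpa using this)
        refine ⟨z, ?_⟩
        simpa using hz
      by_cases hz : z ∈ A
      · obtain ⟨x', y', e, h3, h4, h5, -⟩ := Aux15.cross (h2 x z y hzx hxy.ne.symm) hz hy
        exact ⟨x', y', e, h3, h4, Or.inl h5⟩
      · obtain ⟨x', y', e, h3, h4, -, h5⟩ := Aux15.cross (h2 y x z hxy.ne hzy) hx hz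
        exact ⟨x', y', e, h3, h4, Or.inr h5⟩
    obtain ⟨x', y', e, h3, h4, h5⟩ := hother
    refine (Set.one_lt_ncard_iff (Set.toFinite _)).2
      ⟨s(x, y), s(x', y'), ⟨hxy, x, y, rfl, hx, hy⟩, ⟨e, x', y', rfl, h3, h4⟩, ?_⟩
    intro heq
    rw [Sym2.eq_iff] at heq
    rcases heq with ⟨rfl, rfl⟩ | ⟨rfl, rfl⟩
    · simp at h5
    · exact h4 hx
end
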